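/- In the coordinate transport setting (with Φ of class C⁵, V and W of class C³), the weighted tensor Laplacian of the Calabi tensor g satisfies, for every x ∈ Ω and all indices i, j: (Lg)_{ij} = Σ (Ŵ_{iab} − V_{iab}) Φ^{ac} Φ^{bd} Φ_{jcd} + Σ (Ŵ_{jab} − V_{jab}) Φ^{ac} Φ^{bd} Φ_{icd} + ½ Σ_{s,m} [ (V_{is} + Ŵ_{is}) Φ^{sm} g_{mj} + (V_{js} + Ŵ_{js}) Φ^{sm} g_{mi} ] + 2 Σ (V_{am} + Ŵ_{am}) Φ^{mk} Φ_{kib} Φ^{ac} Φ^{bd} Φ_{cdj} + ½ Σ_{k,m} g_{ki} Φ^{km} g_{mj} + 2 Σ N_{piab} N_{qjcd} Φ^{pq} Φ^{ac} Φ^{bd} + 8 Σ R_{iabc} R_{jpqr} Φ^{ap} Φ^{bq} Φ^{cr}, where N_{piab} := Φ_{piab} − ½ Σ_{k,m} Φ^{km} (Φ_{mpi} Φ_{kab} + Φ_{mpa} Φ_{kib} + Φ_{mpb} Φ_{kia}) and R_{ikjl} := ¼ Σ_{a,m} Φ^{am} (Φ_{ila} Φ_{mkj} − Φ_{ija} Φ_{mkl}).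 -/

import Mathlib

noncomputable section
open scoped BigOperators
open Filter MeasureTheory

/-- Partial derivative `∂_i f`. -/
def pd {n : ℕ} (f : (Fin n → ℝ) → ℝ) (i : Fin n) : (Fin n → ℝ) → ℝ :=
  fun x => fderiv ℝ f x (Pi.single i 1)

/-- Second partial derivative `f_{ij}`. -/
def pd2 {n : ℕ} (f : (Fin n → ℝ) → ℝ) (i j : Fin n) : (Fin n → ℝ) → ℝ :=
  pd (pd f i) j

/-- Third partial derivative `f_{ijk}`. -/
def pd3 {n : ℕ} (f : (Fin n → ℝ) → ℝ) (i j k : Fin n) : (Fin n → ℝ) → ℝ :=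
  pd (pd2 f i j) k

/-- Fourth partial derivative `f_{ijkl}`. -/
def pd4 {n : ℕ} (f : (Fin n → ℝ) → ℝ) (i j k l : Fin n) : (Fin n → ℝ) → ℝ :=
  pd (pd3 f i j k) l

/-- Fifth partial derivative. -/
def pd5 {n : ℕ} (f : (Fin n → ℝ) → ℝ) (i j k l m : Fin n) : (Fin n → ℝ) → ℝ :=
  pd (pd4 f i j k l) m

/-- The Hessian matrix `D²Φ(x)`, with entries `Φ_{ij}(x)`. -/
def hess {n : ℕ} (Φ : (Fin n → ℝ) → ℝ) (x : Fin n → ℝ) : Matrix (Fin n) (Fin n) ℝ :=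
  Matrix.of fun i j => pd2 Φ i j x

/-- The inverse Hessian matrix, with entries `Φ^{ij}(x)`. -/
def ihess {n : ℕ} (Φ : (Fin n → ℝ) → ℝ) (x : Fin n → ℝ) : Matrix (Fin n) (Fin n) ℝ :=
  (hess Φ x)⁻¹

/-- The gradient `∇Φ(x)`. -/
def grad {n : ℕ} (Φ : (Fin n → ℝ) → ℝ) (x : Fin n → ℝ) : Fin n → ℝ :=
  fun i => pd Φ i x

/-- The Calabi tensor `g_{ij} = Σ Φ_{iab} Φ_{jcd} Φ^{ac} Φ^{bd}`. -/
def calabi {n : ℕ} (Φ : (Fin n → ℝ) → ℝ) (i j : Fin n) (x : Fin n → ℝ) : ℝ :=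
  ∑ a, ∑ b, ∑ c, ∑ d,
    pd3 Φ i a b x * pd3 Φ j c d x * ihess Φ x a c * ihess Φ x b d

/-- `W^i := (∂_i W)(∇Φ)`. -/
def Wop {n : ℕ} (Φ W : (Fin n → ℝ) → ℝ) (i : Fin n) (x : Fin n → ℝ) : ℝ :=
  pd W i (grad Φ x)

/-- `Ŵ_{ij} := Σ_{a,b} W^{ab} Φ_{ai} Φ_{bj}` where `W^{ab} = (∂²_{ab}W)(∇Φ)`. -/
def What2 {n : ℕ} (Φ W : (Fin n → ℝ) → ℝ) (i j : Fin n) (x : Fin n → ℝ) : ℝ :=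
  ∑ a, ∑ b, pd2 W a b (grad Φ x) * pd2 Φ a i x * pd2 Φ b j x

/-- `Ŵ_{ijk} := Σ_{a,b,c} W^{abc} Φ_{ai} Φ_{bj} Φ_{ck}` where `W^{abc} = (∂³_{abc}W)(∇Φ)`. -/
def What3 {n : ℕ} (Φ W : (Fin n → ℝ) → ℝ) (i j k : Fin n) (x : Fin n → ℝ) : ℝ :=
  ∑ a, ∑ b, ∑ c, pd3 W a b c (grad Φ x) * pd2 Φ a i x * pd2 Φ b j x * pd2 Φ c k x

/-- Christoffel symbols `Γ^k_{pq} = ½ Σ_m Φ^{km} Φ_{mpq}` of the Hessian metric. -/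
def Γh {n : ℕ} (Φ : (Fin n → ℝ) → ℝ) (k p q : Fin n) (x : Fin n → ℝ) : ℝ :=
  (1/2) * ∑ m, ihess Φ x k m * pd3 Φ m p q x

/-- Covariant derivative of a (0,1)-tensor: `(∇T)_{p i}`. -/
def covD1 {n : ℕ} (Φ : (Fin n → ℝ) → ℝ) (T : Fin n → (Fin n → ℝ) → ℝ)
    (p i : Fin n) (x : Fin n → ℝ) : ℝ :=
  pd (T i) p x - ∑ m, Γh Φ m p i x * T m x

/-- Covariant derivative of a (0,2)-tensor: `(∇T)_{p i j}`. -/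
def covD2 {n : ℕ} (Φ : (Fin n → ℝ) → ℝ) (T : Fin n → Fin n → (Fin n → ℝ) → ℝ)
    (p i j : Fin n) (x : Fin n → ℝ) : ℝ :=
  pd (T i j) p x - ∑ m, Γh Φ m p i x * T m j x - ∑ m, Γh Φ m p j x * T i m x

/-- Covariant derivative of a (0,3)-tensor: `(∇T)_{p i j k}`. -/
def covD3 {n : ℕ} (Φ : (Fin n → ℝ) → ℝ) (T : Fin n → Fin n → Fin n → (Fin n → ℝ) → ℝ)
    (p i j k : Fin n) (x : Fin n → ℝ) : ℝ :=
  pd (T i j k) p x - ∑ m, Γh Φ m p i x * T m j k x - ∑ m, Γh Φ m p j x * T i m k x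
    - ∑ m, Γh Φ m p k x * T i j m x

/-- Covariant derivative of a (0,4)-tensor: `(∇T)_{p i j k l}`. -/
def covD4 {n : ℕ} (Φ : (Fin n → ℝ) → ℝ)
    (T : Fin n → Fin n → Fin n → Fin n → (Fin n → ℝ) → ℝ)
    (p i j k l : Fin n) (x : Fin n → ℝ) : ℝ :=
  pd (T i j k l) p x - ∑ m, Γh Φ m p i x * T m j k l x - ∑ m, Γh Φ m p j x * T i m k l x
    - ∑ m, Γh Φ m p k x * T i j m l x - ∑ m, Γh Φ m p l x * T i j k m x

/-- Weighted tensor Laplacian of a (0,1)-tensor: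
`(LT)_i = Σ Φ^{pq}(∇∇T)_{pq i} − ½ Σ_p (Σ_m Φ^{pm} V_m + W^p)(∇T)_{p i}`. -/
def LT1 {n : ℕ} (Φ V W : (Fin n → ℝ) → ℝ) (T : Fin n → (Fin n → ℝ) → ℝ)
    (i : Fin n) (x : Fin n → ℝ) : ℝ :=
  (∑ p, ∑ q, ihess Φ x p q * covD2 Φ (covD1 Φ T) p q i x)
    - (1/2) * ∑ p, ((∑ m, ihess Φ x p m * pd V m x) + Wop Φ W p x) * covD1 Φ T p i x

/-- Weighted tensor Laplacian of a (0,2)-tensor. -/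
def LT2 {n : ℕ} (Φ V W : (Fin n → ℝ) → ℝ) (T : Fin n → Fin n → (Fin n → ℝ) → ℝ)
    (i j : Fin n) (x : Fin n → ℝ) : ℝ :=
  (∑ p, ∑ q, ihess Φ x p q * covD3 Φ (covD2 Φ T) p q i j x)
    - (1/2) * ∑ p, ((∑ m, ihess Φ x p m * pd V m x) + Wop Φ W p x) * covD2 Φ T p i j x

/-- Weighted tensor Laplacian of a (0,3)-tensor. -/
def LT3 {n : ℕ} (Φ V W : (Fin n → ℝ) → ℝ) (T : Fin n → Fin n → Fin n → (Fin n → ℝ) → ℝ)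
    (i j k : Fin n) (x : Fin n → ℝ) : ℝ :=
  (∑ p, ∑ q, ihess Φ x p q * covD4 Φ (covD3 Φ T) p q i j k x)
    - (1/2) * ∑ p, ((∑ m, ihess Φ x p m * pd V m x) + Wop Φ W p x) * covD3 Φ T p i j k x

/-- `N_{piab} := Φ_{piab} − ½ Σ_{k,m} Φ^{km}(Φ_{mpi}Φ_{kab} + Φ_{mpa}Φ_{kib} + Φ_{mpb}Φ_{kia})`. -/
def Ncal {n : ℕ} (Φ : (Fin n → ℝ) → ℝ) (p i a b : Fin n) (x : Fin n → ℝ) : ℝ :=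
  pd4 Φ p i a b x - (1/2) * ∑ k, ∑ m, ihess Φ x k m *
    (pd3 Φ m p i x * pd3 Φ k a b x + pd3 Φ m p a x * pd3 Φ k i b x
      + pd3 Φ m p b x * pd3 Φ k i a x)

/-- Riemann curvature `R_{ikjl} := ¼ Σ_{a,m} Φ^{am}(Φ_{ila}Φ_{mkj} − Φ_{ija}Φ_{mkl})`. -/
def Rcal {n : ℕ} (Φ : (Fin n → ℝ) → ℝ) (i k j l : Fin n) (x : Fin n → ℝ) : ℝ :=
  (1/4) * ∑ a, ∑ m, ihess Φ x a m *
    (pd3 Φ i l a x * pd3 Φ m k j x - pd3 Φ i j a x * pd3 Φ m k l x)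

/-- The `h`-norm of a quadratic form `Q` at `x`:
`‖Q‖_h(x) = sup { Σ Q_{ij} v_i v_j : Σ Φ_{ij}(x) v_i v_j = 1 }`. -/
def hnorm {n : ℕ} (Φ : (Fin n → ℝ) → ℝ) (Q : Fin n → Fin n → ℝ) (x : Fin n → ℝ) : ℝ :=
  sSup {r | ∃ v : Fin n → ℝ,
    (∑ i, ∑ j, pd2 Φ i j x * v i * v j) = 1 ∧ r = ∑ i, ∑ j, Q i j * v i * v j}

/-- The matrix `A(x)` with entries `V_{ab} + Ŵ_{ab}`. -/
def Amat {n : ℕ} (Φ V W : (Fin n → ℝ) → ℝ) (x : Fin n → ℝ) : Matrix (Fin n) (Fin n) ℝ :=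
  Matrix.of fun a b => pd2 V a b x + What2 Φ W a b x

/-- The matrix `S_i(x)` with entries `V_{iab} − Ŵ_{iab}`. -/
def Smat {n : ℕ} (Φ V W : (Fin n → ℝ) → ℝ) (i : Fin n) (x : Fin n → ℝ) :
    Matrix (Fin n) (Fin n) ℝ :=
  Matrix.of fun a b => pd3 V i a b x - What3 Φ W i a b x

/-- `H_{ij}(x) := Tr[A(x)⁻¹ · S_i(x) · (D²Φ(x))⁻¹ · S_j(x)]`. -/
def Hten {n : ℕ} (Φ V W : (Fin n → ℝ) → ℝ) (i j : Fin n) (x : Fin n → ℝ) : ℝ :=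
  ((Amat Φ V W x)⁻¹ * Smat Φ V W i x * (hess Φ x)⁻¹ * Smat Φ V W j x).trace

/-- Euclidean operator norm of a matrix. -/
def eOpNorm {n : ℕ} (M : Matrix (Fin n) (Fin n) ℝ) : ℝ :=
  ‖LinearMap.toContinuousLinearMap (Matrix.toEuclideanLin M)‖

/-- Directional derivative of the Hessian: the matrix `∂_e D²F(x)`. -/
def dirHess {n : ℕ} (F : (Fin n → ℝ) → ℝ) (e : Fin n → ℝ) (x : Fin n → ℝ) :
    Matrix (Fin n) (Fin n) ℝ :=
  Matrix.of fun i j => ∑ k, e k * pd3 F k i j x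

/-- The quadratic form `⟨Qy, y⟩`. -/
def qform {n : ℕ} (Q : Matrix (Fin n) (Fin n) ℝ) (y : Fin n → ℝ) : ℝ :=
  ∑ i, ∑ j, Q i j * y j * y i

open scoped Matrix

/-- `f` is differentiable at `x` and its `p`-th partial derivative there is `f'`. -/
def HasPd {n : ℕ} (f : (Fin n → ℝ) → ℝ) (p : Fin n) (f' : ℝ) (x : Fin n → ℝ) : Prop :=
  DifferentiableAt ℝ f x ∧ pd f p x = f'

namespace HasPd

variable {n : ℕ} {f g : (Fin n → ℝ) → ℝ} {p : Fin n} {f' g' : ℝ} {x : Fin n → ℝ}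

theorem of_differentiableAt (hf : DifferentiableAt ℝ f x) : HasPd f p (pd f p x) x := ⟨hf, rfl⟩

theorem const (c : ℝ) : HasPd (fun _ : Fin n → ℝ => c) p 0 x :=
  ⟨differentiableAt_const c, by simp [pd]⟩

theorem add (hf : HasPd f p f' x) (hg : HasPd g p g' x) :
    HasPd (fun y => f y + g y) p (f' + g') x :=
  ⟨hf.1.add hg.1, by simp [pd, fderiv_fun_add hf.1 hg.1, ← hf.2, ← hg.2]⟩

theorem sub (hf : HasPd f p f' x) (hg : HasPd g p g' x) :
    HasPd (fun y => f y - g y) p (f' - g') x :=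
  ⟨hf.1.sub hg.1, by simp [pd, fderiv_fun_sub hf.1 hg.1, ← hf.2, ← hg.2]⟩

theorem mul (hf : HasPd f p f' x) (hg : HasPd g p g' x) :
    HasPd (fun y => f y * g y) p (f' * g x + f x * g') x :=
  ⟨hf.1.mul hg.1, by simp [pd, fderiv_fun_mul hf.1 hg.1, ← hf.2, ← hg.2]; ring⟩

theorem const_mul (c : ℝ) (hf : HasPd f p f' x) : HasPd (fun y => c * f y) p (c * f') x := by
  simpa using (const c).mul hf

theorem sum {ι : Type*} {s : Finset ι} {F : ι → (Fin n → ℝ) → ℝ} {F' : ι → ℝ}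
    (h : ∀ i ∈ s, HasPd (F i) p (F' i) x) :
    HasPd (fun y => ∑ i ∈ s, F i y) p (∑ i ∈ s, F' i) x := by
  refine ⟨DifferentiableAt.fun_sum fun i hi => (h i hi).1, ?_⟩
  simp only [pd, fderiv_fun_sum fun i hi => (h i hi).1, sum_apply]
  exact Finset.sum_congr rfl fun i hi => (h i hi).2

theorem prod {ι : Type*} [DecidableEq ι] {s : Finset ι} {F : ι → (Fin n → ℝ) → ℝ} {F' : ι → ℝ}
    (h : ∀ i ∈ s, HasPd (F i) p (F' i) x) :
    HasPd (fun y => ∏ i ∈ s, F i y) p (∑ i ∈ s, (∏ j ∈ s.erase i, F j x) * F' i) x := by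
  have H := HasFDerivAt.finsetProd (u := s) fun i hi => (h i hi).1.hasFDerivAt
  refine ⟨H.differentiableAt, ?_⟩
  simp only [pd, H.fderiv, sum_apply]
  exact Finset.sum_congr rfl fun i hi => by simp [← (h i hi).2, pd]

theorem exp (hf : HasPd f p f' x) :
    HasPd (fun y => Real.exp (f y)) p (Real.exp (f x) * f') x :=
  ⟨hf.1.exp, by simp [pd, fderiv_exp hf.1, ← hf.2]⟩

theorem congr (hf : HasPd f p f' x) (h : f =ᶠ[nhds x] g) : HasPd g p f' x :=
  ⟨hf.1.congr_of_eventuallyEq h.symm, by rw [← hf.2]; simp [pd, h.fderiv_eq]⟩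

theorem congr_on {Ω : Set (Fin n → ℝ)} (hΩ : IsOpen Ω) (hx : x ∈ Ω) (hf : HasPd f p f' x)
    (h : ∀ y ∈ Ω, f y = g y) : HasPd g p f' x :=
  hf.congr (by filter_upwards [hΩ.mem_nhds hx] with y hy using h y hy)

theorem unique (hf : HasPd f p f' x) (hg : HasPd f p g' x) : f' = g' := hf.2.symm.trans hg.2

/-- Chain rule for composition with a map given by its coordinates. -/
theorem comp {G : (Fin n → ℝ) → ℝ} {u : (Fin n → ℝ) → Fin n → ℝ} {u' : Fin n → ℝ}
    (hG : DifferentiableAt ℝ G (u x)) (hu : ∀ a, HasPd (fun y => u y a) p (u' a) x) :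
    HasPd (fun y => G (u y)) p (∑ a, pd G a (u x) * u' a) x := by
  have hud : DifferentiableAt ℝ u x := differentiableAt_pi.2 fun a => (hu a).1
  refine ⟨hG.comp x hud, ?_⟩
  have h1 : fderiv ℝ (fun y => G (u y)) x = (fderiv ℝ G (u x)).comp (fderiv ℝ u x) :=
    fderiv_comp x hG hud
  have h2 : fderiv ℝ u x (Pi.single p 1) = ∑ a, u' a • (Pi.single a (1 : ℝ) : Fin n → ℝ) := by
    ext b
    rw [fderiv_pi fun a => (hu a).1]
    simp [Finset.sum_apply, Pi.single_apply, ← (hu b).2, pd]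
  simp only [pd, h1, ContinuousLinearMap.comp_apply, h2, map_sum, map_smul, smul_eq_mul]
  exact Finset.sum_congr rfl fun a _ => mul_comm _ _

/-- Jacobi's formula. -/
theorem det {A : (Fin n → ℝ) → Matrix (Fin n) (Fin n) ℝ} {A' : Matrix (Fin n) (Fin n) ℝ}
    (h : ∀ i j, HasPd (fun y => A y i j) p (A' i j) x) :
    HasPd (fun y => (A y).det) p (((A x).adjugate * A').trace) x := by
  have H : HasPd (fun y => ∑ σ : Equiv.Perm (Fin n), ((σ.sign : ℤ) : ℝ) * ∏ i, A y (σ i) i) p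
      (∑ σ : Equiv.Perm (Fin n), ((σ.sign : ℤ) : ℝ) *
        ∑ i, (∏ j ∈ Finset.univ.erase i, A x (σ j) j) * A' (σ i) i) x :=
    HasPd.sum fun σ _ => (HasPd.prod fun i _ => h (σ i) i).const_mul _
  simp only [← Matrix.det_apply'] at H
  convert H using 1
  simp only [Finset.mul_sum]
  rw [Finset.sum_comm]
  refine Finset.sum_congr rfl fun i _ => ?_
  have : ((A x).adjugate * A').diag i = ((A x).updateCol i (fun k => A' k i)).det := by
    rw [← Matrix.cramer_apply, Matrix.cramer_eq_adjugate_mulVec]; rfl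
  rw [this, Matrix.det_apply']
  refine Finset.sum_congr rfl fun σ _ => ?_
  congr 1
  rw [← Finset.mul_prod_erase _ _ (Finset.mem_univ i), mul_comm]
  congr 1
  · exact Finset.prod_congr rfl fun j hj => by simp [Matrix.updateCol_ne (Finset.ne_of_mem_erase hj)]
  · simp

end HasPd

section Smooth

variable {n : ℕ} {Ω : Set (Fin n → ℝ)} {f : (Fin n → ℝ) → ℝ} {x : Fin n → ℝ}

theorem contDiffOn_pd {k m : WithTop ℕ∞} (hΩ : IsOpen Ω) (hf : ContDiffOn ℝ k f Ω) (hk : m + 1 ≤ k)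
    (p : Fin n) : ContDiffOn ℝ m (pd f p) Ω :=
  (hf.fderiv_of_isOpen hΩ hk).clm_apply contDiffOn_const

theorem hasPd_of_contDiffOn {k : WithTop ℕ∞} (hΩ : IsOpen Ω) (hf : ContDiffOn ℝ k f Ω) (hk : 1 ≤ k)
    (hx : x ∈ Ω) (p : Fin n) : HasPd f p (pd f p x) x :=
  .of_differentiableAt ((hf.differentiableOn (by positivity)).differentiableAt (hΩ.mem_nhds hx))

theorem pd_congr_on {g : (Fin n → ℝ) → ℝ} (hΩ : IsOpen Ω) (hx : x ∈ Ω) (h : ∀ y ∈ Ω, f y = g y)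
    (p : Fin n) : pd f p x = pd g p x := by
  have : f =ᶠ[nhds x] g := by filter_upwards [hΩ.mem_nhds hx] with y hy using h y hy
  simp [pd, this.fderiv_eq]

theorem pd2_comm {k : WithTop ℕ∞} (hΩ : IsOpen Ω) (hf : ContDiffOn ℝ k f Ω) (hk : 2 ≤ k) (hx : x ∈ Ω)
    (i j : Fin n) : pd2 f i j x = pd2 f j i x := by
  have hc : ContDiffAt ℝ 2 f x := (hf.of_le hk).contDiffAt (hΩ.mem_nhds hx)
  have hs : IsSymmSndFDerivAt ℝ f x := hc.isSymmSndFDerivAt (by simp)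
  have hd : DifferentiableAt ℝ (fderiv ℝ f) x :=
    (hc.fderiv_right (m := 1) (by norm_num)).differentiableAt (by norm_num)
  have key (a b : Fin n) : pd2 f a b x = fderiv ℝ (fderiv ℝ f) x (Pi.single b 1) (Pi.single a 1) := by
    change fderiv ℝ (fun y => fderiv ℝ f y (Pi.single a 1)) x _ = _
    rw [fderiv_clm_apply hd (differentiableAt_const _)]
    simp
  rw [key, key]
  exact hs _ _

end Smooth

/-- A `C⁵` potential on an open set with positive definite Hessian. -/
structure IsHessianPotential {n : ℕ} (Ω : Set (Fin n → ℝ)) (Φ : (Fin n → ℝ) → ℝ) : Prop where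
  isOpen : IsOpen Ω
  contDiffOn : ContDiffOn ℝ 5 Φ Ω
  posDef : ∀ x ∈ Ω, (hess Φ x).PosDef

/-- The third derivatives with the first index raised, `Φ^{ad} Φ_{dbc}`. -/
def raised3 {n : ℕ} (Φ : (Fin n → ℝ) → ℝ) (a b c : Fin n) (x : Fin n → ℝ) : ℝ :=
  ∑ d, ihess Φ x a d * pd3 Φ d b c x

/-- The fourth derivatives with the first index raised, `Φ^{am} Φ_{mbcd}`. -/
def raised4 {n : ℕ} (Φ : (Fin n → ℝ) → ℝ) (a b c d : Fin n) (x : Fin n → ℝ) : ℝ :=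
  ∑ m, ihess Φ x a m * pd4 Φ m b c d x

namespace IsHessianPotential

variable {n : ℕ} {Ω : Set (Fin n → ℝ)} {Φ : (Fin n → ℝ) → ℝ} {x : Fin n → ℝ}

theorem contDiffOn_pd (h : IsHessianPotential Ω Φ) (i : Fin n) : ContDiffOn ℝ 4 (pd Φ i) Ω :=
  _root_.contDiffOn_pd h.isOpen h.contDiffOn (by norm_num) i

theorem contDiffOn_pd2 (h : IsHessianPotential Ω Φ) (i j : Fin n) : ContDiffOn ℝ 3 (pd2 Φ i j) Ω :=
  _root_.contDiffOn_pd h.isOpen (h.contDiffOn_pd i) (by norm_num) j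

theorem contDiffOn_pd3 (h : IsHessianPotential Ω Φ) (i j k : Fin n) :
    ContDiffOn ℝ 2 (pd3 Φ i j k) Ω :=
  _root_.contDiffOn_pd h.isOpen (h.contDiffOn_pd2 i j) (by norm_num) k

theorem contDiffOn_pd4 (h : IsHessianPotential Ω Φ) (i j k l : Fin n) :
    ContDiffOn ℝ 1 (pd4 Φ i j k l) Ω :=
  _root_.contDiffOn_pd h.isOpen (h.contDiffOn_pd3 i j k) (by norm_num) l

theorem hasPd_pd (h : IsHessianPotential Ω Φ) (hx : x ∈ Ω) (i p : Fin n) :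
    HasPd (pd Φ i) p (pd2 Φ i p x) x :=
  hasPd_of_contDiffOn h.isOpen (h.contDiffOn_pd i) (by norm_num) hx p

theorem hasPd_pd2 (h : IsHessianPotential Ω Φ) (hx : x ∈ Ω) (i j p : Fin n) :
    HasPd (pd2 Φ i j) p (pd3 Φ i j p x) x :=
  hasPd_of_contDiffOn h.isOpen (h.contDiffOn_pd2 i j) (by norm_num) hx p

theorem hasPd_pd3 (h : IsHessianPotential Ω Φ) (hx : x ∈ Ω) (i j k p : Fin n) :
    HasPd (pd3 Φ i j k) p (pd4 Φ i j k p x) x :=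
  hasPd_of_contDiffOn h.isOpen (h.contDiffOn_pd3 i j k) (by norm_num) hx p

theorem hasPd_pd4 (h : IsHessianPotential Ω Φ) (hx : x ∈ Ω) (i j k l p : Fin n) :
    HasPd (pd4 Φ i j k l) p (pd5 Φ i j k l p x) x :=
  hasPd_of_contDiffOn h.isOpen (h.contDiffOn_pd4 i j k l) le_rfl hx p

/-! ### Symmetry of the derivatives -/

theorem pd2_comm (h : IsHessianPotential Ω Φ) (hx : x ∈ Ω) (i j : Fin n) :
    pd2 Φ i j x = pd2 Φ j i x :=
  _root_.pd2_comm h.isOpen h.contDiffOn (by norm_num) hx i j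

theorem pd3_swap₁ (h : IsHessianPotential Ω Φ) (hx : x ∈ Ω) (i j k : Fin n) :
    pd3 Φ i j k x = pd3 Φ j i k x :=
  pd_congr_on h.isOpen hx (fun _ hy => h.pd2_comm hy i j) k

theorem pd3_swap₂ (h : IsHessianPotential Ω Φ) (hx : x ∈ Ω) (i j k : Fin n) :
    pd3 Φ i j k x = pd3 Φ i k j x :=
  _root_.pd2_comm h.isOpen (h.contDiffOn_pd i) (by norm_num) hx j k

theorem pd4_swap₁ (h : IsHessianPotential Ω Φ) (hx : x ∈ Ω) (i j k l : Fin n) :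
    pd4 Φ i j k l x = pd4 Φ j i k l x :=
  pd_congr_on h.isOpen hx (fun _ hy => h.pd3_swap₁ hy i j k) l

theorem pd4_swap₂ (h : IsHessianPotential Ω Φ) (hx : x ∈ Ω) (i j k l : Fin n) :
    pd4 Φ i j k l x = pd4 Φ i k j l x :=
  pd_congr_on h.isOpen hx (fun _ hy => h.pd3_swap₂ hy i j k) l

theorem pd4_swap₃ (h : IsHessianPotential Ω Φ) (hx : x ∈ Ω) (i j k l : Fin n) :
    pd4 Φ i j k l x = pd4 Φ i j l k x :=
  _root_.pd2_comm h.isOpen (h.contDiffOn_pd2 i j) (by norm_num) hx k l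

theorem pd5_swap₁ (h : IsHessianPotential Ω Φ) (hx : x ∈ Ω) (i j k l m : Fin n) :
    pd5 Φ i j k l m x = pd5 Φ j i k l m x :=
  pd_congr_on h.isOpen hx (fun _ hy => h.pd4_swap₁ hy i j k l) m

theorem pd5_swap₂ (h : IsHessianPotential Ω Φ) (hx : x ∈ Ω) (i j k l m : Fin n) :
    pd5 Φ i j k l m x = pd5 Φ i k j l m x :=
  pd_congr_on h.isOpen hx (fun _ hy => h.pd4_swap₂ hy i j k l) m

theorem pd5_swap₃ (h : IsHessianPotential Ω Φ) (hx : x ∈ Ω) (i j k l m : Fin n) :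
    pd5 Φ i j k l m x = pd5 Φ i j l k m x :=
  pd_congr_on h.isOpen hx (fun _ hy => h.pd4_swap₃ hy i j k l) m

theorem pd5_swap₄ (h : IsHessianPotential Ω Φ) (hx : x ∈ Ω) (i j k l m : Fin n) :
    pd5 Φ i j k l m x = pd5 Φ i j k m l x :=
  _root_.pd2_comm h.isOpen (h.contDiffOn_pd3 i j k) le_rfl hx l m

/-! ### The inverse Hessian -/

theorem ihess_mul_hess (h : IsHessianPotential Ω Φ) (hx : x ∈ Ω) : ihess Φ x * hess Φ x = 1 :=
  Matrix.nonsing_inv_mul _ (h.posDef x hx).det_pos.ne'.isUnit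

theorem hess_mul_ihess (h : IsHessianPotential Ω Φ) (hx : x ∈ Ω) : hess Φ x * ihess Φ x = 1 :=
  Matrix.mul_nonsing_inv _ (h.posDef x hx).det_pos.ne'.isUnit

theorem ihess_comm (h : IsHessianPotential Ω Φ) (hx : x ∈ Ω) (a b : Fin n) :
    ihess Φ x a b = ihess Φ x b a := by
  have : (hess Φ x)ᵀ = hess Φ x := by ext i j; exact h.pd2_comm hx j i
  have h2 : (ihess Φ x)ᵀ = ihess Φ x := by rw [ihess, Matrix.transpose_nonsing_inv, this]
  exact congrFun (congrFun h2 b) a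

theorem raised3_comm (h : IsHessianPotential Ω Φ) (hx : x ∈ Ω) (a b c : Fin n) :
    raised3 Φ a b c x = raised3 Φ a c b x := by
  simp only [raised3, h.pd3_swap₂ hx _ b c]

/-- Lowering the raised index. -/
theorem sum_pd2_mul_raised3 (h : IsHessianPotential Ω Φ) (hx : x ∈ Ω) (a b c : Fin n) :
    ∑ m, pd2 Φ a m x * raised3 Φ m b c x = pd3 Φ a b c x := by
  have h1 : hess Φ x *ᵥ (ihess Φ x *ᵥ fun d => pd3 Φ d b c x) = fun d => pd3 Φ d b c x := by
    rw [Matrix.mulVec_mulVec, h.hess_mul_ihess hx, Matrix.one_mulVec]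
  exact congrFun h1 a

theorem differentiableAt_ihess (h : IsHessianPotential Ω Φ) (hx : x ∈ Ω) (a b : Fin n) :
    DifferentiableAt ℝ (fun y => ihess Φ y a b) x := by
  have hdet : DifferentiableAt ℝ (fun y => (hess Φ y).det) x :=
    (HasPd.det (p := a) (A' := fun i j => pd3 Φ i j a x) fun i j => h.hasPd_pd2 hx i j a).1
  have hadj : DifferentiableAt ℝ (fun y => (hess Φ y).adjugate a b) x := by
    simp only [Matrix.adjugate_apply]
    refine (HasPd.det (p := a) (A' := fun i j => pd
      (fun y => (hess Φ y).updateRow b (Pi.single a 1) i j) a x) fun i j => ⟨?_, rfl⟩).1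
    by_cases hi : i = b
    · subst hi; simp
    · simp only [Matrix.updateRow_ne hi]
      exact (h.hasPd_pd2 hx i j a).1
  have : (fun y => ihess Φ y a b) = fun y => (hess Φ y).det⁻¹ * (hess Φ y).adjugate a b := by
    ext y; simp [ihess, Matrix.inv_def]
  rw [this]
  exact (hdet.inv (h.posDef x hx).det_pos.ne').mul hadj

theorem hasPd_ihess (h : IsHessianPotential Ω Φ) (hx : x ∈ Ω) (a b p : Fin n) :
    HasPd (fun y => ihess Φ y a b) p (-∑ k, raised3 Φ a k p x * ihess Φ x k b) x := by
  refine ⟨h.differentiableAt_ihess hx a b, ?_⟩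
  set D : Matrix (Fin n) (Fin n) ℝ := Matrix.of fun a b => pd (fun y => ihess Φ y a b) p x with hD
  set T : Matrix (Fin n) (Fin n) ℝ := Matrix.of fun a b => pd3 Φ a b p x with hT
  have key : D * hess Φ x + ihess Φ x * T = 0 := by
    ext i j
    have h1 : HasPd (fun y => ∑ k, ihess Φ y i k * pd2 Φ k j y) p
        (∑ k, (D i k * pd2 Φ k j x + ihess Φ x i k * pd3 Φ k j p x)) x :=
      HasPd.sum fun k _ => HasPd.mul ⟨h.differentiableAt_ihess hx i k, rfl⟩ (h.hasPd_pd2 hx k j p)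
    have h2 := h1.congr_on (g := fun _ => (1 : Matrix (Fin n) (Fin n) ℝ) i j) h.isOpen hx
      fun y hy => by rw [← h.ihess_mul_hess hy, Matrix.mul_apply]; rfl
    have h3 := h2.unique (HasPd.const _)
    rw [Finset.sum_add_distrib] at h3
    simpa [Matrix.mul_apply, hess, hT] using h3
  have h4 : D = -(ihess Φ x * T * ihess Φ x) := by
    have := congrArg (· * ihess Φ x) (eq_neg_of_add_eq_zero_left key)
    simpa [Matrix.mul_assoc, h.hess_mul_ihess hx] using this
  have h5 := congrFun (congrFun h4 a) b
  simpa [hD, Matrix.mul_apply, raised3, hT] using h5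

theorem hasPd_raised3 (h : IsHessianPotential Ω Φ) (hx : x ∈ Ω) (a b c p : Fin n) :
    HasPd (raised3 Φ a b c) p
      (-∑ r, raised3 Φ a r p x * raised3 Φ r b c x + raised4 Φ a b c p x) x := by
  have h1 : HasPd (raised3 Φ a b c) p (∑ d, ((-∑ k, raised3 Φ a k p x * ihess Φ x k d) *
      pd3 Φ d b c x + ihess Φ x a d * pd4 Φ d b c p x)) x :=
    HasPd.sum fun d _ => (h.hasPd_ihess hx a d p).mul (h.hasPd_pd3 hx d b c p)
  convert h1 using 1
  rw [Finset.sum_add_distrib]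
  congr 1
  simp only [neg_mul, Finset.sum_neg_distrib, Finset.sum_mul]
  rw [Finset.sum_comm]
  simp only [mul_assoc, ← Finset.mul_sum, raised3]

end IsHessianPotential

/-- A Hessian potential transporting `e^{-V}` to `e^{-W}`. -/
structure IsTransport {n : ℕ} (Ω : Set (Fin n → ℝ)) (Φ V W : (Fin n → ℝ) → ℝ) : Prop
    extends IsHessianPotential Ω Φ where
  contDiffOn_source : ContDiffOn ℝ 3 V Ω
  contDiff_target : ContDiff ℝ 3 W
  monge_ampere : ∀ x ∈ Ω, Real.exp (-V x) = Real.exp (-W (grad Φ x)) * (hess Φ x).det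

/-- The full trace `tr (h⁻¹ Φ_i h⁻¹ Φ_j h⁻¹ Φ_k)` of three third-derivative matrices. -/
def cubicTrace {n : ℕ} (Φ : (Fin n → ℝ) → ℝ) (i j k : Fin n) (x : Fin n → ℝ) : ℝ :=
  ∑ a, ∑ b, ∑ c, raised3 Φ a b i x * raised3 Φ b c j x * raised3 Φ c a k x

/-- The contraction `Φ_{iab} Φ^{ac} Φ^{bd} Φ_{cdjk}`. -/
def mixedTrace {n : ℕ} (Φ : (Fin n → ℝ) → ℝ) (i j k : Fin n) (x : Fin n → ℝ) : ℝ :=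
  ∑ a, ∑ b, raised3 Φ a b i x * raised4 Φ b a j k x

/-- The contraction `Φ^{ab} Φ_{abij}`. -/
def traced4 {n : ℕ} (Φ : (Fin n → ℝ) → ℝ) (i j : Fin n) (x : Fin n → ℝ) : ℝ :=
  ∑ a, ∑ b, ihess Φ x a b * pd4 Φ b a i j x

namespace IsHessianPotential

variable {n : ℕ} {Ω : Set (Fin n → ℝ)} {Φ : (Fin n → ℝ) → ℝ} {x : Fin n → ℝ}

theorem calabi_eq (h : IsHessianPotential Ω Φ) (hx : x ∈ Ω) (i j : Fin n) :
    calabi Φ i j x = ∑ a, ∑ b, raised3 Φ a b i x * raised3 Φ b a j x := by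
  have h1 (a d : Fin n) : raised3 Φ d a i x = ∑ b, pd3 Φ i a b x * ihess Φ x b d :=
    Finset.sum_congr rfl fun b _ => by
      rw [h.ihess_comm hx b d, h.pd3_swap₁ hx i a b, h.pd3_swap₂ hx a i b, h.pd3_swap₁ hx a b i]
      ring
  have h2 (a d : Fin n) : raised3 Φ a d j x = ∑ c, pd3 Φ j c d x * ihess Φ x a c :=
    Finset.sum_congr rfl fun c _ => by
      rw [h.pd3_swap₁ hx j c d, h.pd3_swap₂ hx c j d]
      ring
  rw [Finset.sum_comm, calabi]
  refine Finset.sum_congr rfl fun a _ => ?_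
  simp only [h1, h2, Finset.sum_mul_sum]
  rw [Finset.sum_comm]
  conv_lhs => enter [2, c]; rw [Finset.sum_comm]
  rw [Finset.sum_comm]
  refine Finset.sum_congr rfl fun d _ => ?_
  rw [Finset.sum_comm]
  exact Finset.sum_congr rfl fun b _ => Finset.sum_congr rfl fun c _ => by ring

end IsHessianPotential

namespace IsTransport

variable {n : ℕ} {Ω : Set (Fin n → ℝ)} {Φ V W : (Fin n → ℝ) → ℝ} {x : Fin n → ℝ}

theorem contDiffOn_target (h : IsTransport Ω Φ V W) : ContDiffOn ℝ 3 W Set.univ :=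
  h.contDiff_target.contDiffOn

theorem hasPd_comp_grad (h : IsTransport Ω Φ V W) (hx : x ∈ Ω) {G : (Fin n → ℝ) → ℝ}
    (hG : ContDiffOn ℝ 1 G Set.univ) (p : Fin n) :
    HasPd (fun y => G (grad Φ y)) p (∑ a, pd G a (grad Φ x) * pd2 Φ a p x) x :=
  HasPd.comp ((contDiffOn_univ.1 hG).differentiable (by norm_num) _) fun a => h.hasPd_pd hx a p

theorem hasPd_Wop (h : IsTransport Ω Φ V W) (hx : x ∈ Ω) (a p : Fin n) :
    HasPd (Wop Φ W a) p (∑ c, pd2 W a c (grad Φ x) * pd2 Φ c p x) x :=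
  h.hasPd_comp_grad hx (contDiffOn_pd isOpen_univ h.contDiffOn_target (by norm_num) a) p

theorem hasPd_pd2_target (h : IsTransport Ω Φ V W) (hx : x ∈ Ω) (a b p : Fin n) :
    HasPd (fun y => pd2 W a b (grad Φ y)) p (∑ c, pd3 W a b c (grad Φ x) * pd2 Φ c p x) x :=
  h.hasPd_comp_grad hx (contDiffOn_pd isOpen_univ
    (contDiffOn_pd isOpen_univ h.contDiffOn_target (m := 2) (by norm_num) a) (by norm_num) b) p

theorem pd2_target_comm (h : IsTransport Ω Φ V W) (y : Fin n → ℝ) (a b : Fin n) :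
    pd2 W a b y = pd2 W b a y :=
  pd2_comm isOpen_univ h.contDiffOn_target (by norm_num) (Set.mem_univ y) a b

/-- The logarithmic derivative of the Monge–Ampère equation. -/
theorem pd_source (h : IsTransport Ω Φ V W) (hx : x ∈ Ω) (i : Fin n) :
    pd V i x = ∑ a, Wop Φ W a x * pd2 Φ a i x - ∑ a, ∑ b, ihess Φ x a b * pd3 Φ b a i x := by
  have hdet := (h.posDef x hx).det_pos
  have hV := ((hasPd_of_contDiffOn h.isOpen h.contDiffOn_source (by norm_num) hx i).const_mul
    (-1)).exp
  have hW := ((h.hasPd_comp_grad hx (h.contDiffOn_target.of_le (by norm_num)) i).const_mul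
    (-1)).exp.mul (HasPd.det (A := hess Φ) (A' := Matrix.of fun a b => pd3 Φ a b i x)
      fun a b => h.hasPd_pd2 hx a b i)
  have key := hV.unique (hW.congr_on h.isOpen hx fun y hy => by
    simpa using (h.monge_ampere y hy).symm)
  have hadj : (hess Φ x).adjugate = (hess Φ x).det • ihess Φ x := by
    rw [ihess, Matrix.inv_def, smul_smul, Ring.inverse_eq_inv', mul_inv_cancel₀ hdet.ne', one_smul]
  have hMA := h.monge_ampere x hx
  have htr : ((hess Φ x).adjugate * Matrix.of fun a b => pd3 Φ a b i x).trace
      = (hess Φ x).det * ∑ a, ∑ b, ihess Φ x a b * pd3 Φ b a i x := by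
    rw [hadj, Matrix.smul_mul, Matrix.trace_smul, smul_eq_mul]
    simp [Matrix.trace, Matrix.mul_apply]
  simp only [neg_one_mul, hMA, htr] at key
  have hne : Real.exp (-W (grad Φ x)) * (hess Φ x).det ≠ 0 := by positivity
  apply mul_left_cancel₀ hne
  simp only [Wop]
  linear_combination -key

theorem pd2_source (h : IsTransport Ω Φ V W) (hx : x ∈ Ω) (i j : Fin n) :
    pd2 V i j x = What2 Φ W i j x + ∑ a, Wop Φ W a x * pd3 Φ a i j x + calabi Φ i j x
      - traced4 Φ i j x := by
  have h1 : HasPd (fun y => ∑ a, Wop Φ W a y * pd2 Φ a i y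
      - ∑ a, ∑ b, ihess Φ y a b * pd3 Φ b a i y) j _ x :=
    (HasPd.sum fun a _ => (h.hasPd_Wop hx a j).mul (h.hasPd_pd2 hx a i j)).sub
      (HasPd.sum fun a _ => HasPd.sum fun b _ => (h.hasPd_ihess hx a b j).mul
        (h.hasPd_pd3 hx b a i j))
  have h2 := (h1.congr_on h.isOpen hx fun y hy => (h.pd_source hy i).symm).2
  rw [pd2, h2]
  simp only [Finset.sum_add_distrib]
  have hg : calabi Φ i j x
      = -∑ a, ∑ b, (-∑ k, raised3 Φ a k j x * ihess Φ x k b) * pd3 Φ b a i x := by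
    rw [h.calabi_eq hx, Finset.sum_comm]
    simp only [neg_mul, Finset.sum_neg_distrib, neg_neg]
    refine Finset.sum_congr rfl fun a _ => ?_
    simp only [Finset.sum_mul]
    rw [Finset.sum_comm]
    refine Finset.sum_congr rfl fun k _ => ?_
    simp only [mul_assoc, ← Finset.mul_sum]
    exact mul_comm _ _
  have hW : What2 Φ W i j x
      = ∑ a, (∑ c, pd2 W a c (grad Φ x) * pd2 Φ c j x) * pd2 Φ a i x := by
    simp only [What2, Finset.sum_mul]
    exact Finset.sum_congr rfl fun a _ => Finset.sum_congr rfl fun b _ => by ring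
  rw [hg, hW, traced4]
  ring

/-- Contracting `Ŵ` with a raised third derivative. -/
theorem sum_What2_mul_raised3 (h : IsTransport Ω Φ V W) (hx : x ∈ Ω) (k i j : Fin n) :
    ∑ l, What2 Φ W k l x * raised3 Φ l i j x
      = ∑ a, ∑ b, pd2 W a b (grad Φ x) * pd2 Φ a k x * pd3 Φ b i j x := by
  simp only [What2, ← h.sum_pd2_mul_raised3 hx _ i j, Finset.sum_mul, Finset.mul_sum]
  rw [Finset.sum_comm]
  refine Finset.sum_congr rfl fun a _ => ?_
  rw [Finset.sum_comm]
  exact Finset.sum_congr rfl fun a _ => Finset.sum_congr rfl fun b _ => by ring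

theorem sum_ihess_mul_pd5 (h : IsTransport Ω Φ V W) (hx : x ∈ Ω) (i j k : Fin n) :
    ∑ a, ∑ b, ihess Φ x a b * pd5 Φ b a i j k x
      = What3 Φ W i j k x - pd3 V i j k x
        + (∑ l, What2 Φ W i l x * raised3 Φ l j k x + ∑ l, What2 Φ W j l x * raised3 Φ l i k x
          + ∑ l, What2 Φ W k l x * raised3 Φ l i j x)
        + ∑ a, Wop Φ W a x * pd4 Φ a i j k x
        + (mixedTrace Φ i j k x + mixedTrace Φ j i k x + mixedTrace Φ k i j x)
        - (cubicTrace Φ j k i x + cubicTrace Φ j i k x) := by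
  have h1 : HasPd (fun y => ∑ a, ∑ b, pd2 W a b (grad Φ y) * pd2 Φ a i y * pd2 Φ b j y
      + ∑ a, Wop Φ W a y * pd3 Φ a i j y + ∑ a, ∑ b, raised3 Φ a b i y * raised3 Φ b a j y
      - ∑ a, ∑ b, ihess Φ y a b * pd4 Φ b a i j y) k _ x :=
    (((HasPd.sum fun a _ => HasPd.sum fun b _ => ((h.hasPd_pd2_target hx a b k).mul
        (h.hasPd_pd2 hx a i k)).mul (h.hasPd_pd2 hx b j k)).add
      (HasPd.sum fun a _ => (h.hasPd_Wop hx a k).mul (h.hasPd_pd3 hx a i j k))).add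
      (HasPd.sum fun a _ => HasPd.sum fun b _ => (h.hasPd_raised3 hx a b i k).mul
        (h.hasPd_raised3 hx b a j k))).sub
      (HasPd.sum fun a _ => HasPd.sum fun b _ => (h.hasPd_ihess hx a b k).mul
        (h.hasPd_pd4 hx b a i j k))
  have h2 := (h1.congr_on (g := pd2 V i j) h.isOpen hx fun y hy => by
    rw [← h.calabi_eq hy]; exact (h.pd2_source hy i j).symm).2
  rw [pd3, h2]
  simp only [Finset.sum_add_distrib, add_mul, mul_add]
  have e1 : What3 Φ W i j k x = ∑ a, ∑ b, (∑ c, pd3 W a b c (grad Φ x) * pd2 Φ c k x)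
      * pd2 Φ a i x * pd2 Φ b j x := by
    simp only [What3, Finset.sum_mul]
    exact Finset.sum_congr rfl fun a _ => Finset.sum_congr rfl fun b _ =>
      Finset.sum_congr rfl fun c _ => by ring
  have e2 : ∑ l, What2 Φ W j l x * raised3 Φ l i k x
      = ∑ a, ∑ b, pd2 W a b (grad Φ x) * pd3 Φ a i k x * pd2 Φ b j x := by
    rw [h.sum_What2_mul_raised3 hx, Finset.sum_comm]
    exact Finset.sum_congr rfl fun a _ => Finset.sum_congr rfl fun b _ => by
      rw [h.pd2_target_comm]; ring
  have e3 : ∑ l, What2 Φ W k l x * raised3 Φ l i j x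
      = ∑ a, (∑ c, pd2 W a c (grad Φ x) * pd2 Φ c k x) * pd3 Φ a i j x := by
    simp only [h.sum_What2_mul_raised3 hx, Finset.sum_mul]
    rw [Finset.sum_comm]
    exact Finset.sum_congr rfl fun a _ => Finset.sum_congr rfl fun b _ => by
      rw [h.pd2_target_comm]
  have e4 : ∑ a, ∑ b, (-∑ m, raised3 Φ a m k x * ihess Φ x m b) * pd4 Φ b a i j x
      = -mixedTrace Φ k i j x := by
    simp only [neg_mul, Finset.sum_neg_distrib, neg_inj, mixedTrace]
    refine Finset.sum_congr rfl fun a _ => ?_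
    simp only [Finset.sum_mul, raised4, Finset.mul_sum]
    rw [Finset.sum_comm]
    exact Finset.sum_congr rfl fun a _ => Finset.sum_congr rfl fun b _ => by ring
  have e5 : ∑ a, ∑ b, raised4 Φ a b i k x * raised3 Φ b a j x = mixedTrace Φ j i k x := by
    rw [mixedTrace, Finset.sum_comm]
    exact Finset.sum_congr rfl fun a _ => Finset.sum_congr rfl fun b _ => by ring
  have e6 : ∑ a, ∑ b, (-∑ r, raised3 Φ a r k x * raised3 Φ r b i x) * raised3 Φ b a j x
      = -cubicTrace Φ j k i x := by
    simp only [neg_mul, Finset.sum_neg_distrib, neg_inj, cubicTrace, Finset.sum_mul]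
    rw [Finset.sum_comm]
    refine Finset.sum_congr rfl fun b _ => Finset.sum_congr rfl fun a _ =>
      Finset.sum_congr rfl fun c _ => by ring
  have e7 : ∑ a, ∑ b, raised3 Φ a b i x * (-∑ r, raised3 Φ b r k x * raised3 Φ r a j x)
      = -cubicTrace Φ j i k x := by
    simp only [mul_neg, Finset.sum_neg_distrib, neg_inj, cubicTrace, Finset.mul_sum]
    conv_rhs => rw [Finset.sum_comm]
    refine Finset.sum_congr rfl fun b _ => ?_
    rw [Finset.sum_comm]
    refine Finset.sum_congr rfl fun a _ => Finset.sum_congr rfl fun c _ => by ring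
  rw [e4, e5, e6, e7, e1, e2, e3, h.sum_What2_mul_raised3 hx, mixedTrace.eq_def Φ i]
  ring

end IsTransport

/-- The contraction `A_{ab} B_{cd} H^{ac} H^{bd}`. -/
def pairing {n : ℕ} (H : Matrix (Fin n) (Fin n) ℝ) (A B : Fin n → Fin n → ℝ) : ℝ :=
  ∑ a, ∑ b, ∑ c, ∑ d, A a b * B c d * H a c * H b d

section Pairing

variable {n : ℕ} (H : Matrix (Fin n) (Fin n) ℝ)

theorem pairing_sub_left (A A' B : Fin n → Fin n → ℝ) :
    pairing H (fun a b => A a b - A' a b) B = pairing H A B - pairing H A' B := by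
  simp only [pairing, sub_mul, Finset.sum_sub_distrib]

theorem pairing_sub_right (A B B' : Fin n → Fin n → ℝ) :
    pairing H A (fun a b => B a b - B' a b) = pairing H A B - pairing H A B' := by
  simp only [pairing, sub_mul, mul_sub, Finset.sum_sub_distrib]

theorem pairing_add_left (A A' B : Fin n → Fin n → ℝ) :
    pairing H (fun a b => A a b + A' a b) B = pairing H A B + pairing H A' B := by
  simp only [pairing, add_mul, Finset.sum_add_distrib]

theorem pairing_const_mul_left (r : ℝ) (A B : Fin n → Fin n → ℝ) :
    pairing H (fun a b => r * A a b) B = r * pairing H A B := by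
  simp only [pairing, mul_assoc, ← Finset.mul_sum]

theorem pairing_const_mul_right (r : ℝ) (A B : Fin n → Fin n → ℝ) :
    pairing H A (fun a b => r * B a b) = r * pairing H A B := by
  simp only [pairing, mul_assoc, mul_left_comm _ r, ← Finset.mul_sum]

theorem pairing_sum_left {ι : Type*} (s : Finset ι) (A : ι → Fin n → Fin n → ℝ)
    (B : Fin n → Fin n → ℝ) :
    pairing H (fun a b => ∑ m ∈ s, A m a b) B = ∑ m ∈ s, pairing H (A m) B := by
  classical
  induction s using Finset.induction_on with
  | empty => simp [pairing]
  | insert m s hm ih =>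
    simp only [Finset.sum_insert hm]
    rw [pairing_add_left, ih]

theorem pairing_comm {H : Matrix (Fin n) (Fin n) ℝ} (hH : ∀ a b, H a b = H b a)
    (A B : Fin n → Fin n → ℝ) : pairing H A B = pairing H B A := by
  have (A B : Fin n → Fin n → ℝ) : pairing H A B
      = ∑ u : Fin n × Fin n, ∑ v : Fin n × Fin n, A u.1 u.2 * B v.1 v.2 * H u.1 v.1 * H u.2 v.2 := by
    simp only [pairing, Fintype.sum_prod_type]
  rw [this, this, Finset.sum_comm]
  exact Finset.sum_congr rfl fun u _ => Finset.sum_congr rfl fun v _ => by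
    rw [hH v.1, hH v.2]; ring

theorem pairing_sum_right {H : Matrix (Fin n) (Fin n) ℝ} (hH : ∀ a b, H a b = H b a) {ι : Type*}
    (s : Finset ι) (A : Fin n → Fin n → ℝ) (B : ι → Fin n → Fin n → ℝ) :
    pairing H A (fun a b => ∑ m ∈ s, B m a b) = ∑ m ∈ s, pairing H A (B m) := by
  simp only [pairing_comm hH A, pairing_sum_left]

theorem sum_contraction_eq_trace (A B G K : Matrix (Fin n) (Fin n) ℝ) :
    ∑ a, ∑ b, ∑ c, ∑ d, A a b * B c d * G a c * K b d = (Aᵀ * G * B * Kᵀ).trace := by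
  simp only [Matrix.trace, Matrix.diag_apply, Matrix.mul_apply, Matrix.transpose_apply,
    Finset.sum_mul]
  rw [Finset.sum_comm]
  refine Finset.sum_congr rfl fun b _ => ?_
  rw [Finset.sum_comm]
  conv_lhs => enter [2, c]; rw [Finset.sum_comm]
  rw [Finset.sum_comm]
  exact Finset.sum_congr rfl fun d _ => Finset.sum_congr rfl fun c _ =>
    Finset.sum_congr rfl fun a _ => by ring

end Pairing

namespace IsHessianPotential

variable {n : ℕ} {Ω : Set (Fin n → ℝ)} {Φ : (Fin n → ℝ) → ℝ} {x : Fin n → ℝ}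

theorem Γh_eq (Φ : (Fin n → ℝ) → ℝ) (k p q : Fin n) (x : Fin n → ℝ) :
    Γh Φ k p q x = 1 / 2 * raised3 Φ k p q x := rfl

/-- The Hessian metric is parallel: the covariant derivative is a derivation for contractions. -/
theorem hasPd_pairing (h : IsHessianPotential Ω Φ) (hx : x ∈ Ω)
    {A B : Fin n → Fin n → (Fin n → ℝ) → ℝ} (hA : ∀ a b, DifferentiableAt ℝ (A a b) x)
    (hB : ∀ a b, DifferentiableAt ℝ (B a b) x) (p : Fin n) :
    HasPd (fun y => pairing (ihess Φ y) (fun a b => A a b y) (fun a b => B a b y)) p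
      (pairing (ihess Φ x) (fun a b => covD2 Φ A p a b x) (fun a b => B a b x)
        + pairing (ihess Φ x) (fun a b => A a b x) (fun a b => covD2 Φ B p a b x)) x := by
  have h1 : HasPd (fun y => ∑ a, ∑ b, ∑ c, ∑ d, A a b y * B c d y * ihess Φ y a c * ihess Φ y b d)
      p _ x :=
    HasPd.sum fun a _ => HasPd.sum fun b _ => HasPd.sum fun c _ => HasPd.sum fun d _ =>
      (((HasPd.of_differentiableAt (hA a b)).mul (HasPd.of_differentiableAt (hB c d))).mul
        (h.hasPd_ihess hx a c p)).mul (h.hasPd_ihess hx b d p)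
  refine ⟨h1.1, h1.2.trans ?_⟩
  set H : Matrix (Fin n) (Fin n) ℝ := ihess Φ x
  set M : Matrix (Fin n) (Fin n) ℝ := Matrix.of fun a k => raised3 Φ a k p x with hM
  set A₀ : Matrix (Fin n) (Fin n) ℝ := Matrix.of fun a b => A a b x with hA₀
  set B₀ : Matrix (Fin n) (Fin n) ℝ := Matrix.of fun a b => B a b x with hB₀
  set A₁ : Matrix (Fin n) (Fin n) ℝ := Matrix.of fun a b => pd (A a b) p x with hA₁
  set B₁ : Matrix (Fin n) (Fin n) ℝ := Matrix.of fun a b => pd (B a b) p x with hB₁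
  have hH : Hᵀ = H := by ext a b; exact h.ihess_comm hx b a
  have hMH : H * Mᵀ = M * H := by
    set T : Matrix (Fin n) (Fin n) ℝ := Matrix.of fun a b => pd3 Φ a b p x with hT
    have h2 : M = H * T := by ext a b; simp [hM, hT, Matrix.mul_apply, raised3, H]
    have h3 : Tᵀ = T := by ext a b; exact h.pd3_swap₁ hx b a p
    rw [h2, Matrix.transpose_mul, hH, h3, Matrix.mul_assoc]
  have hD {F : Fin n → Fin n → (Fin n → ℝ) → ℝ} : (fun a b => covD2 Φ F p a b x)
      = (Matrix.of fun a b => pd (F a b) p x) - (1 / 2 : ℝ) • (Mᵀ * Matrix.of fun a b => F a b x)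
        - (1 / 2 : ℝ) • ((Matrix.of fun a b => F a b x) * M) := by
    ext a b
    simp only [covD2, Γh_eq, Matrix.sub_apply, Matrix.smul_apply, Matrix.mul_apply,
      Matrix.transpose_apply, Matrix.of_apply, hM, smul_eq_mul, Finset.mul_sum,
      h.raised3_comm hx _ p]
    congr 1
    · simp only [mul_assoc]
    · exact Finset.sum_congr rfl fun m _ => by ring
  have hlhs : ∑ a, ∑ b, ∑ c, ∑ d, (((pd (A a b) p x * B c d x + A a b x * pd (B c d) p x)
        * ihess Φ x a c + A a b x * B c d x * -∑ k, raised3 Φ a k p x * ihess Φ x k c)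
        * ihess Φ x b d
      + A a b x * B c d x * ihess Φ x a c * -∑ k, raised3 Φ b k p x * ihess Φ x k d)
      = (A₁ᵀ * H * B₀ * Hᵀ).trace + (A₀ᵀ * H * B₁ * Hᵀ).trace
        + (A₀ᵀ * (-(M * H)) * B₀ * Hᵀ).trace + (A₀ᵀ * H * B₀ * (-(M * H))ᵀ).trace := by
    simp only [← sum_contraction_eq_trace, ← Finset.sum_add_distrib]
    refine Finset.sum_congr rfl fun a _ => Finset.sum_congr rfl fun b _ =>
      Finset.sum_congr rfl fun c _ => Finset.sum_congr rfl fun d _ => ?_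
    simp only [Matrix.neg_apply, Matrix.mul_apply, hM, hA₀, hA₁, hB₀, hB₁, Matrix.of_apply, H]
    ring
  rw [hlhs, hD, hD]
  refine Eq.trans ?_ (congrArg₂ (· + ·)
    (sum_contraction_eq_trace (A₁ - (1 / 2 : ℝ) • (Mᵀ * A₀) - (1 / 2 : ℝ) • (A₀ * M)) B₀ H H)
    (sum_contraction_eq_trace A₀
      (B₁ - (1 / 2 : ℝ) • (Mᵀ * B₀) - (1 / 2 : ℝ) • (B₀ * M)) H H)).symm
  have t1 : (Mᵀ * A₀ᵀ * H * B₀ * H).trace = (A₀ᵀ * H * B₀ * (M * H)).trace := by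
    rw [← hMH, Matrix.trace_mul_comm (A₀ᵀ * H * B₀), Matrix.mul_assoc H, Matrix.trace_mul_comm H]
    simp only [Matrix.mul_assoc]
  have t2 : A₀ᵀ * H * (Mᵀ * B₀) * H = A₀ᵀ * (M * H) * B₀ * H := by
    rw [← hMH]; simp only [Matrix.mul_assoc]
  have t3 : A₀ᵀ * H * (B₀ * M) * H = A₀ᵀ * H * B₀ * (M * H) := by
    simp only [Matrix.mul_assoc]
  have t4 : A₀ᵀ * M * H * B₀ * H = A₀ᵀ * (M * H) * B₀ * H := by
    simp only [Matrix.mul_assoc]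
  simp only [hH, Matrix.transpose_neg, Matrix.transpose_sub, Matrix.transpose_smul,
    Matrix.transpose_mul, Matrix.transpose_transpose, Matrix.sub_mul, Matrix.mul_sub,
    Matrix.smul_mul, Matrix.mul_smul, Matrix.trace_sub, Matrix.trace_smul, Matrix.neg_mul,
    Matrix.mul_neg, Matrix.trace_neg, smul_eq_mul, t1, t2, t3, t4, hMH]
  ring

end IsHessianPotential

/-- The contraction `Φ_{pqk} Φ^{km} Φ_{mab}`. -/
def thirdSq {n : ℕ} (Φ : (Fin n → ℝ) → ℝ) (p q a b : Fin n) (x : Fin n → ℝ) : ℝ :=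
  ∑ m, raised3 Φ m p q x * pd3 Φ m a b x

namespace IsHessianPotential

variable {n : ℕ} {Ω : Set (Fin n → ℝ)} {Φ : (Fin n → ℝ) → ℝ} {x : Fin n → ℝ}

theorem hasPd_thirdSq (h : IsHessianPotential Ω Φ) (hx : x ∈ Ω) (q i a b p : Fin n) :
    HasPd (thirdSq Φ q i a b) p
      (∑ m, ((-∑ r, raised3 Φ m r p x * raised3 Φ r q i x + raised4 Φ m q i p x) * pd3 Φ m a b x
        + raised3 Φ m q i x * pd4 Φ m a b p x)) x :=
  HasPd.sum fun m _ => (h.hasPd_raised3 hx m q i p).mul (h.hasPd_pd3 hx m a b p)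

theorem covD3_pd3 (h : IsHessianPotential Ω Φ) (hx : x ∈ Ω) (q i a b : Fin n) :
    covD3 Φ (pd3 Φ) q i a b x = pd4 Φ i a b q x
      - 1 / 2 * (thirdSq Φ q i a b x + thirdSq Φ q a i b x + thirdSq Φ q b i a x) := by
  have e1 : ∑ m, Γh Φ m q i x * pd3 Φ m a b x = 1 / 2 * thirdSq Φ q i a b x := by
    simp only [Γh_eq, thirdSq, mul_assoc, ← Finset.mul_sum]
  have e2 : ∑ m, Γh Φ m q a x * pd3 Φ i m b x = 1 / 2 * thirdSq Φ q a i b x := by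
    simp only [Γh_eq, thirdSq, mul_assoc, ← Finset.mul_sum, h.pd3_swap₁ hx i]
  have e3 : ∑ m, Γh Φ m q b x * pd3 Φ i a m x = 1 / 2 * thirdSq Φ q b i a x := by
    simp only [Γh_eq, thirdSq, mul_assoc, ← Finset.mul_sum, h.pd3_swap₁ hx _ i,
      h.pd3_swap₂ hx i _ a]
  rw [covD3, e1, e2, e3, pd4]
  ring

theorem hasPd_covD3_pd3 (h : IsHessianPotential Ω Φ) (hx : x ∈ Ω) (q i a b p : Fin n) :
    HasPd (covD3 Φ (pd3 Φ) q i a b) p (pd5 Φ i a b q p x - 1 / 2 * (pd (thirdSq Φ q i a b) p x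
      + pd (thirdSq Φ q a i b) p x + pd (thirdSq Φ q b i a) p x)) x := by
  have hs (a b c d : Fin n) := HasPd.of_differentiableAt (p := p) (h.hasPd_thirdSq hx a b c d p).1
  have h1 := (h.hasPd_pd4 hx i a b q p).sub
    ((((hs q i a b).add (hs q a i b)).add (hs q b i a)).const_mul (1 / 2))
  exact h1.congr_on h.isOpen hx fun y hy => (h.covD3_pd3 hy q i a b).symm

theorem covD3_pd3_eq_Ncal (h : IsHessianPotential Ω Φ) (hx : x ∈ Ω) (p i a b : Fin n) :
    covD3 Φ (pd3 Φ) p i a b x = Ncal Φ p i a b x := by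
  rw [h.covD3_pd3 hx, Ncal, h.pd4_swap₁ hx p, h.pd4_swap₂ hx i p, h.pd4_swap₃ hx i a p]
  congr 2
  simp only [thirdSq, raised3, ← Finset.sum_add_distrib]
  refine Finset.sum_congr rfl fun k _ => ?_
  simp only [Finset.sum_mul, ← Finset.sum_add_distrib]
  exact Finset.sum_congr rfl fun m _ => by ring

/-- Leibniz rule for the first covariant derivative of the Calabi tensor. -/
theorem covD2_calabi (h : IsHessianPotential Ω Φ) (hx : x ∈ Ω) (p i j : Fin n) :
    covD2 Φ (calabi Φ) p i j x
      = pairing (ihess Φ x) (fun a b => covD3 Φ (pd3 Φ) p i a b x) (fun a b => pd3 Φ j a b x)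
        + pairing (ihess Φ x) (fun a b => pd3 Φ i a b x)
          (fun a b => covD3 Φ (pd3 Φ) p j a b x) := by
  have hd (i a b : Fin n) := (h.hasPd_pd3 hx i a b p).1
  have h1 : pd (calabi Φ i j) p x = _ := (h.hasPd_pairing hx (hd i) (hd j) p).2
  have h2 (k a b : Fin n) : covD3 Φ (pd3 Φ) p k a b x
      = covD2 Φ (pd3 Φ k) p a b x - ∑ m, Γh Φ m p k x * pd3 Φ m a b x := by
    simp only [covD3, covD2]; ring
  simp only [h2]
  rw [pairing_sub_left, pairing_sub_right, pairing_sum_left, pairing_sum_right (h.ihess_comm hx)]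
  simp only [pairing_const_mul_left, pairing_const_mul_right]
  rw [covD2, h1]
  simp only [calabi, pairing]
  ring

/-- Leibniz rule for the second covariant derivative of the Calabi tensor. -/
theorem covD3_covD2_calabi (h : IsHessianPotential Ω Φ) (hx : x ∈ Ω) (p q i j : Fin n) :
    covD3 Φ (covD2 Φ (calabi Φ)) p q i j x
      = pairing (ihess Φ x) (fun a b => covD4 Φ (covD3 Φ (pd3 Φ)) p q i a b x)
          (fun a b => pd3 Φ j a b x)
        + pairing (ihess Φ x) (fun a b => covD3 Φ (pd3 Φ) q i a b x)
          (fun a b => covD3 Φ (pd3 Φ) p j a b x)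
        + (pairing (ihess Φ x) (fun a b => covD3 Φ (pd3 Φ) p i a b x)
          (fun a b => covD3 Φ (pd3 Φ) q j a b x)
        + pairing (ihess Φ x) (fun a b => pd3 Φ i a b x)
          (fun a b => covD4 Φ (covD3 Φ (pd3 Φ)) p q j a b x)) := by
  have hd (i a b : Fin n) := (h.hasPd_pd3 hx i a b p).1
  have hd' (i a b : Fin n) := (h.hasPd_covD3_pd3 hx q i a b p).1
  have h1 : pd (covD2 Φ (calabi Φ) q i j) p x = _ :=
    (((h.hasPd_pairing hx (hd' i) (hd j) p).add (h.hasPd_pairing hx (hd i) (hd' j) p)).congr_on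
      h.isOpen hx fun y hy => (h.covD2_calabi hy q i j).symm).2
  have h2 (k a b : Fin n) : covD3 Φ (pd3 Φ) p k a b x
      = covD2 Φ (pd3 Φ k) p a b x - ∑ m, Γh Φ m p k x * pd3 Φ m a b x := by
    simp only [covD3, covD2]; ring
  have h3 (k a b : Fin n) : covD4 Φ (covD3 Φ (pd3 Φ)) p q k a b x
      = covD2 Φ (covD3 Φ (pd3 Φ) q k) p a b x
        - ∑ m, Γh Φ m p q x * covD3 Φ (pd3 Φ) m k a b x
        - ∑ m, Γh Φ m p k x * covD3 Φ (pd3 Φ) q m a b x := by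
    simp only [covD4, covD2]; ring
  simp only [h3]
  have h4 (k : Fin n) : (fun a b => covD3 Φ (pd3 Φ) p k a b x)
      = fun a b => covD2 Φ (pd3 Φ k) p a b x - ∑ m, Γh Φ m p k x * pd3 Φ m a b x :=
    funext fun a => funext fun b => h2 k a b
  rw [h4 i, h4 j]
  simp only [pairing_sub_left, pairing_sub_right, pairing_sum_left,
    pairing_sum_right (h.ihess_comm hx), pairing_const_mul_left, pairing_const_mul_right]
  rw [covD3, h1]
  simp only [h.covD2_calabi hx, mul_add, Finset.sum_add_distrib]
  ring

theorem LT2_calabi (h : IsHessianPotential Ω Φ) (hx : x ∈ Ω) (V W : (Fin n → ℝ) → ℝ)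
    (i j : Fin n) :
    LT2 Φ V W (calabi Φ) i j x
      = pairing (ihess Φ x) (fun a b => LT3 Φ V W (pd3 Φ) i a b x) (fun a b => pd3 Φ j a b x)
        + pairing (ihess Φ x) (fun a b => LT3 Φ V W (pd3 Φ) j a b x) (fun a b => pd3 Φ i a b x)
        + 2 * ∑ p, ∑ q, ihess Φ x p q * pairing (ihess Φ x)
          (fun a b => Ncal Φ p i a b x) (fun a b => Ncal Φ q j a b x) := by
  have hcomm : ∑ p, ∑ q, ihess Φ x p q * pairing (ihess Φ x)
        (fun a b => covD3 Φ (pd3 Φ) q i a b x) (fun a b => covD3 Φ (pd3 Φ) p j a b x)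
      = ∑ p, ∑ q, ihess Φ x p q * pairing (ihess Φ x)
        (fun a b => covD3 Φ (pd3 Φ) p i a b x) (fun a b => covD3 Φ (pd3 Φ) q j a b x) := by
    rw [Finset.sum_comm]
    exact Finset.sum_congr rfl fun p _ => Finset.sum_congr rfl fun q _ => by rw [h.ihess_comm hx]
  rw [pairing_comm (h.ihess_comm hx) (fun a b => LT3 Φ V W (pd3 Φ) j a b x)]
  simp only [LT3, LT2, pairing_sub_left, pairing_sub_right, pairing_sum_left,
    pairing_sum_right (h.ihess_comm hx), pairing_const_mul_left, pairing_const_mul_right,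
    h.covD3_covD2_calabi hx, h.covD2_calabi hx, ← h.covD3_pd3_eq_Ncal hx, mul_add,
    Finset.sum_add_distrib]
  rw [hcomm]
  ring

end IsHessianPotential

namespace IsHessianPotential

variable {n : ℕ} {Ω : Set (Fin n → ℝ)} {Φ : (Fin n → ℝ) → ℝ} {x : Fin n → ℝ}

/-! ### Symmetries of the contractions -/

/-- Moving a raised index across a contraction. -/
theorem sum_raise_mul (h : IsHessianPotential Ω Φ) (hx : x ∈ Ω) (u v : Fin n → ℝ) :
    ∑ m, (∑ k, ihess Φ x m k * u k) * v m = ∑ m, u m * ∑ k, ihess Φ x m k * v k := by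
  simp only [Finset.sum_mul, Finset.mul_sum]
  rw [Finset.sum_comm]
  exact Finset.sum_congr rfl fun m _ => Finset.sum_congr rfl fun k _ => by
    rw [h.ihess_comm hx k m]; ring

theorem thirdSq_eq (h : IsHessianPotential Ω Φ) (hx : x ∈ Ω) (p q a b : Fin n) :
    thirdSq Φ p q a b x = ∑ m, pd3 Φ m p q x * raised3 Φ m a b x :=
  h.sum_raise_mul hx _ _

theorem thirdSq_swap_left (h : IsHessianPotential Ω Φ) (hx : x ∈ Ω) (p q a b : Fin n) :
    thirdSq Φ p q a b x = thirdSq Φ q p a b x := by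
  simp only [thirdSq, h.raised3_comm hx _ p q]

theorem sum_ihess_mul_thirdSq (h : IsHessianPotential Ω Φ) (hx : x ∈ Ω) (p c d e : Fin n) :
    ∑ q, ihess Φ x p q * thirdSq Φ q c d e x
      = ∑ r, raised3 Φ p r c x * raised3 Φ r d e x := by
  simp only [h.thirdSq_eq hx, Finset.mul_sum]
  rw [Finset.sum_comm]
  refine Finset.sum_congr rfl fun r _ => ?_
  rw [raised3.eq_def Φ p r c, Finset.sum_mul]
  exact Finset.sum_congr rfl fun q _ => by rw [h.pd3_swap₁ hx r q c]; ring

theorem calabi_comm (h : IsHessianPotential Ω Φ) (hx : x ∈ Ω) (i j : Fin n) :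
    calabi Φ i j x = calabi Φ j i x :=
  pairing_comm (h.ihess_comm hx) (fun a b => pd3 Φ i a b x) fun a b => pd3 Φ j a b x

theorem covD3_pd3_swap₁ (h : IsHessianPotential Ω Φ) (hx : x ∈ Ω) (q i a b : Fin n) :
    covD3 Φ (pd3 Φ) q i a b x = covD3 Φ (pd3 Φ) q a i b x := by
  rw [h.covD3_pd3 hx, h.covD3_pd3 hx, h.pd4_swap₁ hx i a]
  simp only [thirdSq, h.pd3_swap₂ hx _ i a]
  ring

theorem covD3_pd3_swap₂ (h : IsHessianPotential Ω Φ) (hx : x ∈ Ω) (q i a b : Fin n) :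
    covD3 Φ (pd3 Φ) q i a b x = covD3 Φ (pd3 Φ) q i b a x := by
  rw [h.covD3_pd3 hx, h.covD3_pd3 hx, h.pd4_swap₂ hx i a]
  simp only [thirdSq, h.pd3_swap₂ hx _ a b]
  ring

/-- The matrix of third derivatives `(Φ^{ad} Φ_{dbi})_{ab}`. -/
def raisedMatrix (Φ : (Fin n → ℝ) → ℝ) (i : Fin n) (x : Fin n → ℝ) : Matrix (Fin n) (Fin n) ℝ :=
  Matrix.of fun a b => raised3 Φ a b i x

theorem cubicTrace_eq (Φ : (Fin n → ℝ) → ℝ) (i j k : Fin n) (x : Fin n → ℝ) :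
    cubicTrace Φ i j k x
      = (raisedMatrix Φ i x * (raisedMatrix Φ j x * raisedMatrix Φ k x)).trace := by
  simp only [cubicTrace, Matrix.trace, Matrix.diag_apply, Matrix.mul_apply, raisedMatrix,
    Matrix.of_apply, Finset.mul_sum, mul_assoc]

theorem cubicTrace_rotate (Φ : (Fin n → ℝ) → ℝ) (i j k : Fin n) (x : Fin n → ℝ) :
    cubicTrace Φ i j k x = cubicTrace Φ j k i x := by
  rw [cubicTrace_eq, cubicTrace_eq, Matrix.trace_mul_comm, Matrix.mul_assoc]

theorem cubicTrace_swap (h : IsHessianPotential Ω Φ) (hx : x ∈ Ω) (i j k : Fin n) :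
    cubicTrace Φ i j k x = cubicTrace Φ i k j x := by
  set H : Matrix (Fin n) (Fin n) ℝ := ihess Φ x
  set T : Fin n → Matrix (Fin n) (Fin n) ℝ := fun i => Matrix.of fun a b => pd3 Φ a b i x with hT
  have hM (i : Fin n) : raisedMatrix Φ i x = H * T i := by
    ext a b; simp [raisedMatrix, raised3, Matrix.mul_apply, hT, H]
  have hH : Hᵀ = H := by ext a b; exact h.ihess_comm hx b a
  have hTt (i : Fin n) : (T i)ᵀ = T i := by ext a b; exact h.pd3_swap₁ hx b a i
  rw [cubicTrace_eq, cubicTrace_eq, ← Matrix.trace_transpose]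
  simp only [hM, Matrix.transpose_mul, hH, hTt]
  rw [Matrix.trace_mul_comm]
  simp only [Matrix.mul_assoc]
  simpa only [Matrix.mul_assoc] using Matrix.trace_mul_comm (T i * H * T k * H * T j) H

/-! ### Contractions with the inverse Hessian -/

theorem sum_ihess_mul_sum_raised3_mul (Φ : (Fin n → ℝ) → ℝ) (x : Fin n → ℝ) (i : Fin n)
    (F : Fin n → Fin n → ℝ) :
    ∑ p, ∑ q, ihess Φ x p q * ∑ m, raised3 Φ m p i x * F q m
      = ∑ m, ∑ p, raised3 Φ m p i x * ∑ q, ihess Φ x p q * F q m := by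
  simp only [Finset.mul_sum]
  conv_lhs => enter [2, p]; rw [Finset.sum_comm]
  rw [Finset.sum_comm]
  exact Finset.sum_congr rfl fun m _ => Finset.sum_congr rfl fun p _ =>
    Finset.sum_congr rfl fun q _ => by ring

theorem contract_raised3_pd4 (h : IsHessianPotential Ω Φ) (hx : x ∈ Ω) (i a b : Fin n) :
    ∑ p, ∑ q, ihess Φ x p q * ∑ m, raised3 Φ m p i x * pd4 Φ m a b q x
      = mixedTrace Φ i a b x := by
  rw [sum_ihess_mul_sum_raised3_mul Φ x i fun q m => pd4 Φ m a b q x]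
  refine Finset.sum_congr rfl fun m _ => Finset.sum_congr rfl fun p _ => ?_
  rw [raised4]
  congr 1
  refine Finset.sum_congr rfl fun q _ => ?_
  rw [h.pd4_swap₃ hx m a b, h.pd4_swap₂ hx m a q, h.pd4_swap₁ hx m q]

theorem contract_raised3_thirdSq (h : IsHessianPotential Ω Φ) (hx : x ∈ Ω) (i a b : Fin n) :
    ∑ p, ∑ q, ihess Φ x p q * ∑ m, raised3 Φ m p i x * thirdSq Φ q m a b x
      = ∑ r, calabi Φ i r x * raised3 Φ r a b x := by
  rw [sum_ihess_mul_sum_raised3_mul Φ x i fun q m => thirdSq Φ q m a b x]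
  simp only [h.sum_ihess_mul_thirdSq hx, h.calabi_eq hx, Finset.mul_sum, Finset.sum_mul]
  conv_lhs => enter [2, m]; rw [Finset.sum_comm]
  rw [Finset.sum_comm]
  exact Finset.sum_congr rfl fun r _ => Finset.sum_congr rfl fun m _ =>
    Finset.sum_congr rfl fun p _ => by rw [h.raised3_comm hx p r m]; ring

theorem contract_raised3_thirdSq_cross (h : IsHessianPotential Ω Φ) (hx : x ∈ Ω)
    (i a b : Fin n) :
    ∑ p, ∑ q, ihess Φ x p q * ∑ m, raised3 Φ m p i x * thirdSq Φ q a m b x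
      = cubicTrace Φ i a b x := by
  rw [sum_ihess_mul_sum_raised3_mul Φ x i fun q m => thirdSq Φ q a m b x]
  simp only [h.sum_ihess_mul_thirdSq hx, cubicTrace, Finset.mul_sum, mul_assoc]

theorem contract_raised4_pd3 (h : IsHessianPotential Ω Φ) (hx : x ∈ Ω) (i a b : Fin n) :
    ∑ p, ∑ q, ihess Φ x p q * ∑ m, raised4 Φ m q i p x * pd3 Φ m a b x
      = ∑ m, traced4 Φ i m x * raised3 Φ m a b x := by
  have h1 (p q : Fin n) : ∑ m, raised4 Φ m q i p x * pd3 Φ m a b x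
      = ∑ m, pd4 Φ q p i m x * raised3 Φ m a b x := by
    refine (h.sum_raise_mul hx (fun k => pd4 Φ k q i p x) fun k => pd3 Φ k a b x).trans ?_
    refine Finset.sum_congr rfl fun m _ => ?_
    rw [h.pd4_swap₃ hx m q, h.pd4_swap₁ hx m q, h.pd4_swap₂ hx q m, h.pd4_swap₃ hx q p m, raised3]
  simp only [h1, traced4, Finset.mul_sum, Finset.sum_mul]
  conv_lhs => enter [2, m]; rw [Finset.sum_comm]
  rw [Finset.sum_comm]
  exact Finset.sum_congr rfl fun r _ => Finset.sum_congr rfl fun m _ =>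
    Finset.sum_congr rfl fun p _ => by ring

theorem sum_ihess_swap (h : IsHessianPotential Ω Φ) (hx : x ∈ Ω) (F : Fin n → Fin n → ℝ) :
    ∑ p, ∑ q, ihess Φ x p q * F p q = ∑ p, ∑ q, ihess Φ x p q * F q p := by
  rw [Finset.sum_comm]
  exact Finset.sum_congr rfl fun p _ => Finset.sum_congr rfl fun q _ => by rw [h.ihess_comm hx]

theorem contract_pd_thirdSq (h : IsHessianPotential Ω Φ) (hx : x ∈ Ω) (i a b : Fin n) :
    ∑ p, ∑ q, ihess Φ x p q * pd (thirdSq Φ q i a b) p x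
      = ∑ m, traced4 Φ i m x * raised3 Φ m a b x - ∑ m, calabi Φ i m x * raised3 Φ m a b x
        + mixedTrace Φ i a b x := by
  have h1 (p q : Fin n) : pd (thirdSq Φ q i a b) p x
      = ∑ m, raised4 Φ m q i p x * pd3 Φ m a b x
        - ∑ r, raised3 Φ r q i x * thirdSq Φ p r a b x
        + ∑ m, raised3 Φ m q i x * pd4 Φ m a b p x := by
    have h2 : ∑ r, raised3 Φ r q i x * thirdSq Φ p r a b x
        = ∑ m, (∑ r, raised3 Φ m r p x * raised3 Φ r q i x) * pd3 Φ m a b x := by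
      simp only [thirdSq, Finset.mul_sum, Finset.sum_mul]
      rw [Finset.sum_comm]
      exact Finset.sum_congr rfl fun m _ => Finset.sum_congr rfl fun r _ => by
        rw [h.raised3_comm hx m p r]; ring
    rw [(h.hasPd_thirdSq hx q i a b p).2, h2]
    simp only [add_mul, neg_mul, Finset.sum_add_distrib, Finset.sum_neg_distrib]
    ring
  simp only [h1, mul_add, mul_sub, Finset.sum_add_distrib, Finset.sum_sub_distrib]
  rw [h.contract_raised4_pd3 hx,
    h.sum_ihess_swap hx fun p q => ∑ r, raised3 Φ r q i x * thirdSq Φ p r a b x,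
    h.contract_raised3_thirdSq hx,
    h.sum_ihess_swap hx fun p q => ∑ m, raised3 Φ m q i x * pd4 Φ m a b p x,
    h.contract_raised3_pd4 hx]

theorem contract_raised3_covD3_pd3 (h : IsHessianPotential Ω Φ) (hx : x ∈ Ω) (i a b : Fin n) :
    ∑ p, ∑ q, ihess Φ x p q * ∑ m, raised3 Φ m p i x * covD3 Φ (pd3 Φ) q m a b x
      = mixedTrace Φ i a b x - 1 / 2 * ∑ m, calabi Φ i m x * raised3 Φ m a b x
        - cubicTrace Φ i a b x := by
  have h1 (p q : Fin n) : ∑ m, raised3 Φ m p i x * covD3 Φ (pd3 Φ) q m a b x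
      = ∑ m, raised3 Φ m p i x * pd4 Φ m a b q x
        - 1 / 2 * (∑ m, raised3 Φ m p i x * thirdSq Φ q m a b x
          + ∑ m, raised3 Φ m p i x * thirdSq Φ q a m b x
          + ∑ m, raised3 Φ m p i x * thirdSq Φ q b m a x) := by
    simp only [h.covD3_pd3 hx, mul_sub, mul_add, Finset.sum_add_distrib, Finset.sum_sub_distrib,
      mul_left_comm _ (1 / 2 : ℝ), ← Finset.mul_sum]
  simp only [h1, mul_sub, mul_add, Finset.sum_add_distrib, Finset.sum_sub_distrib,
    mul_left_comm _ (1 / 2 : ℝ), ← Finset.mul_sum]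
  rw [h.contract_raised3_pd4 hx, h.contract_raised3_thirdSq hx,
    h.contract_raised3_thirdSq_cross hx, h.contract_raised3_thirdSq_cross hx,
    h.cubicTrace_swap hx i b a]
  ring

end IsHessianPotential

namespace IsTransport

variable {n : ℕ} {Ω : Set (Fin n → ℝ)} {Φ V W : (Fin n → ℝ) → ℝ} {x : Fin n → ℝ}

/-- The drift of the weighted Laplacian combines with the contracted Christoffel symbols. -/
theorem drift_eq (h : IsTransport Ω Φ V W) (hx : x ∈ Ω) (m : Fin n) :
    ∑ p, ∑ q, ihess Φ x p q * raised3 Φ m p q x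
      + (∑ k, ihess Φ x m k * pd V k x + Wop Φ W m x) = 2 * Wop Φ W m x := by
  have h1 : ∑ k, ihess Φ x m k * ∑ a, Wop Φ W a x * pd2 Φ a k x = Wop Φ W m x := by
    have h2 : ihess Φ x *ᵥ (hess Φ x *ᵥ fun a => Wop Φ W a x) = fun a => Wop Φ W a x := by
      rw [Matrix.mulVec_mulVec, h.ihess_mul_hess hx, Matrix.one_mulVec]
    refine Eq.trans (Finset.sum_congr rfl fun k _ => ?_) (congrFun h2 m)
    congr 1
    exact Finset.sum_congr rfl fun a _ => by rw [h.pd2_comm hx, mul_comm]; rfl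
  have h3 : ∑ k, ihess Φ x m k * ∑ a, ∑ b, ihess Φ x a b * pd3 Φ b a k x
      = ∑ p, ∑ q, ihess Φ x p q * raised3 Φ m p q x := by
    simp only [raised3, Finset.mul_sum]
    rw [Finset.sum_comm]
    refine Finset.sum_congr rfl fun p _ => ?_
    rw [Finset.sum_comm]
    exact Finset.sum_congr rfl fun q _ => Finset.sum_congr rfl fun k _ => by
      rw [h.pd3_swap₁ hx q, h.pd3_swap₂ hx p, h.pd3_swap₁ hx p]; ring
  simp only [h.pd_source hx, mul_sub, Finset.sum_sub_distrib, h1, h3]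
  ring

theorem sum_Wop_mul_thirdSq (h : IsTransport Ω Φ V W) (hx : x ∈ Ω) (i a b : Fin n) :
    ∑ m, Wop Φ W m x * thirdSq Φ m i a b x
      = ∑ k, (pd2 V i k x - What2 Φ W i k x - calabi Φ i k x + traced4 Φ i k x)
        * raised3 Φ k a b x := by
  simp only [h.thirdSq_eq hx, Finset.mul_sum]
  rw [Finset.sum_comm]
  refine Finset.sum_congr rfl fun k _ => ?_
  rw [h.pd2_source hx]
  simp only [← mul_assoc, ← Finset.sum_mul]
  congr 1
  have : ∑ m, Wop Φ W m x * pd3 Φ k m i x = ∑ m, Wop Φ W m x * pd3 Φ m i k x :=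
    Finset.sum_congr rfl fun m _ => by rw [h.pd3_swap₁ hx k, h.pd3_swap₂ hx m]
  rw [this]
  ring

/-- The weighted Laplacian of the cubic form `Φ_{iab}`. -/
theorem LT3_pd3 (h : IsTransport Ω Φ V W) (hx : x ∈ Ω) (i a b : Fin n) :
    LT3 Φ V W (pd3 Φ) i a b x
      = What3 Φ W i a b x - pd3 V i a b x
        + 1 / 2 * (∑ k, (pd2 V i k x + What2 Φ W i k x + 1 / 2 * calabi Φ i k x) * raised3 Φ k a b x
          + ∑ k, (pd2 V a k x + What2 Φ W a k x + 1 / 2 * calabi Φ a k x) * raised3 Φ k i b x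
          + ∑ k, (pd2 V b k x + What2 Φ W b k x + 1 / 2 * calabi Φ b k x) * raised3 Φ k i a x)
        - 1 / 2 * cubicTrace Φ i a b x := by
  have h1 (p q : Fin n) : covD4 Φ (covD3 Φ (pd3 Φ)) p q i a b x
      = pd5 Φ p q i a b x - 1 / 2 * (pd (thirdSq Φ q i a b) p x
          + pd (thirdSq Φ q a i b) p x + pd (thirdSq Φ q b i a) p x)
        - 1 / 2 * ∑ m, raised3 Φ m p q x * covD3 Φ (pd3 Φ) m i a b x
        - 1 / 2 * (∑ m, raised3 Φ m p i x * covD3 Φ (pd3 Φ) q m a b x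
          + ∑ m, raised3 Φ m p a x * covD3 Φ (pd3 Φ) q m i b x
          + ∑ m, raised3 Φ m p b x * covD3 Φ (pd3 Φ) q m i a x) := by
    have e1 (m : Fin n) : covD3 Φ (pd3 Φ) q i m b x = covD3 Φ (pd3 Φ) q m i b x :=
      h.covD3_pd3_swap₁ hx q i m b
    have e2 (m : Fin n) : covD3 Φ (pd3 Φ) q i a m x = covD3 Φ (pd3 Φ) q m i a x := by
      rw [h.covD3_pd3_swap₂ hx, h.covD3_pd3_swap₁ hx]
    have e3 : pd5 Φ i a b q p x = pd5 Φ p q i a b x := by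
      rw [h.pd5_swap₄ hx, h.pd5_swap₃ hx, h.pd5_swap₂ hx, h.pd5_swap₁ hx,
        h.pd5_swap₄ hx, h.pd5_swap₃ hx, h.pd5_swap₂ hx]
    rw [covD4, (h.hasPd_covD3_pd3 hx q i a b p).2, e3]
    simp only [e1, e2, IsHessianPotential.Γh_eq, mul_assoc, ← Finset.mul_sum]
    ring
  have h5 : ∑ p, ∑ q, ihess Φ x p q * pd5 Φ p q i a b x
      = ∑ p, ∑ q, ihess Φ x p q * pd5 Φ q p i a b x := by
    simp only [h.pd5_swap₁ hx]
  have h6 : ∑ p, ∑ q, ihess Φ x p q * ∑ m, raised3 Φ m p q x * covD3 Φ (pd3 Φ) m i a b x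
      = ∑ m, (∑ p, ∑ q, ihess Φ x p q * raised3 Φ m p q x) * covD3 Φ (pd3 Φ) m i a b x := by
    simp only [Finset.mul_sum, Finset.sum_mul, mul_assoc]
    conv_lhs => enter [2, p]; rw [Finset.sum_comm]
    rw [Finset.sum_comm]
  have h7 : 1 / 2 * ∑ m, (∑ p, ∑ q, ihess Φ x p q * raised3 Φ m p q x) * covD3 Φ (pd3 Φ) m i a b x
      + 1 / 2 * ∑ m, (∑ k, ihess Φ x m k * pd V k x + Wop Φ W m x) * covD3 Φ (pd3 Φ) m i a b x
      = ∑ m, Wop Φ W m x * pd4 Φ m i a b x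
        - 1 / 2 * (∑ m, Wop Φ W m x * thirdSq Φ m i a b x
          + ∑ m, Wop Φ W m x * thirdSq Φ m a i b x + ∑ m, Wop Φ W m x * thirdSq Φ m b i a x) := by
    rw [← mul_add, ← Finset.sum_add_distrib]
    simp only [← add_mul, h.drift_eq hx, h.covD3_pd3 hx, Finset.mul_sum,
      ← Finset.sum_add_distrib, ← Finset.sum_sub_distrib]
    exact Finset.sum_congr rfl fun m _ => by
      rw [h.pd4_swap₁ hx m, h.pd4_swap₂ hx i m, h.pd4_swap₃ hx i a m]; ring
  simp only [LT3, h1, mul_sub, mul_add, Finset.sum_add_distrib, Finset.sum_sub_distrib,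
    mul_left_comm _ (1 / 2 : ℝ), ← Finset.mul_sum]
  rw [h5, h6, h.sum_ihess_mul_pd5 hx]
  simp only [h.contract_pd_thirdSq hx, h.contract_raised3_covD3_pd3 hx]
  rw [h.cubicTrace_swap hx a i b, ← IsHessianPotential.cubicTrace_rotate Φ i a b,
    IsHessianPotential.cubicTrace_rotate Φ b i a]
  have h8 := h.sum_Wop_mul_thirdSq hx i a b
  have h9 := h.sum_Wop_mul_thirdSq hx a i b
  have h10 := h.sum_Wop_mul_thirdSq hx b i a
  simp only [add_mul, sub_mul, mul_assoc, Finset.sum_add_distrib, Finset.sum_sub_distrib,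
    ← Finset.mul_sum] at h7 h8 h9 h10 ⊢
  linear_combination -h7 + 1 / 2 * (h8 + h9 + h10)

end IsTransport

theorem sum_comm_pairs {n : ℕ} (f : Fin n → Fin n → Fin n → Fin n → ℝ) :
    ∑ a, ∑ b, ∑ c, ∑ d, f a b c d = ∑ c, ∑ d, ∑ a, ∑ b, f a b c d := by
  have (f : Fin n → Fin n → Fin n → Fin n → ℝ) : ∑ a, ∑ b, ∑ c, ∑ d, f a b c d
      = ∑ u : Fin n × Fin n, ∑ v : Fin n × Fin n, f u.1 u.2 v.1 v.2 := by
    simp only [Fintype.sum_prod_type]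
  rw [this, this fun c d a b => f a b c d, Finset.sum_comm]

theorem pairing_transpose_left {n : ℕ} (H : Matrix (Fin n) (Fin n) ℝ) (A : Fin n → Fin n → ℝ)
    {B : Fin n → Fin n → ℝ} (hB : ∀ a b, B a b = B b a) :
    pairing H (fun a b => A b a) B = pairing H A B := by
  rw [pairing, Finset.sum_comm]
  refine Finset.sum_congr rfl fun a _ => Finset.sum_congr rfl fun b _ => ?_
  rw [Finset.sum_comm]
  exact Finset.sum_congr rfl fun c _ => Finset.sum_congr rfl fun d _ => by rw [hB d c]; ring

/-- The contraction `Z_{abc} Y_{pqr} H^{ap} H^{bq} H^{cr}`. -/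
def triplePairing {n : ℕ} (H : Matrix (Fin n) (Fin n) ℝ) (Z Y : Fin n → Fin n → Fin n → ℝ) : ℝ :=
  ∑ a, ∑ b, ∑ c, ∑ p, ∑ q, ∑ r, Z a b c * Y p q r * H a p * H b q * H c r

section TriplePairing

variable {n : ℕ} {H : Matrix (Fin n) (Fin n) ℝ}

theorem triplePairing_comm (hH : ∀ a b, H a b = H b a) (Z Y : Fin n → Fin n → Fin n → ℝ) :
    triplePairing H Z Y = triplePairing H Y Z := by
  have (Z Y : Fin n → Fin n → Fin n → ℝ) : triplePairing H Z Y
      = ∑ u : Fin n × Fin n × Fin n, ∑ v : Fin n × Fin n × Fin n,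
        Z u.1 u.2.1 u.2.2 * Y v.1 v.2.1 v.2.2 * H u.1 v.1 * H u.2.1 v.2.1 * H u.2.2 v.2.2 := by
    simp only [triplePairing, Fintype.sum_prod_type]
  rw [this, this, Finset.sum_comm]
  exact Finset.sum_congr rfl fun u _ => Finset.sum_congr rfl fun v _ => by
    rw [hH v.1, hH v.2.1, hH v.2.2]; ring

theorem triplePairing_swap (Z Y : Fin n → Fin n → Fin n → ℝ) :
    triplePairing H (fun a b c => Z a c b) (fun a b c => Y a c b) = triplePairing H Z Y := by
  refine Finset.sum_congr rfl fun a _ => ?_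
  rw [Finset.sum_comm]
  refine Finset.sum_congr rfl fun b _ => Finset.sum_congr rfl fun c _ =>
    Finset.sum_congr rfl fun p _ => ?_
  rw [Finset.sum_comm]
  exact Finset.sum_congr rfl fun q _ => Finset.sum_congr rfl fun r _ => by ring

theorem triplePairing_sub_sub (Z Z' Y Y' : Fin n → Fin n → Fin n → ℝ) :
    triplePairing H (fun a b c => Z a b c - Z' a b c) (fun a b c => Y a b c - Y' a b c)
      = triplePairing H Z Y - triplePairing H Z Y' - triplePairing H Z' Y
        + triplePairing H Z' Y' := by
  simp only [triplePairing, sub_mul, mul_sub, Finset.sum_sub_distrib]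
  ring

theorem triplePairing_eq_sum_pairing (Z Y : Fin n → Fin n → Fin n → ℝ) :
    triplePairing H Z Y
      = ∑ c, ∑ r, H c r * pairing H (fun a b => Z a b c) (fun p q => Y p q r) := by
  simp only [pairing, Finset.mul_sum]
  rw [sum_comm_pairs]
  refine Finset.sum_congr rfl fun a _ => Finset.sum_congr rfl fun b _ =>
    Finset.sum_congr rfl fun c _ => ?_
  conv_rhs => rw [Finset.sum_comm]; enter [2, p]; rw [Finset.sum_comm]
  exact Finset.sum_congr rfl fun p _ => Finset.sum_congr rfl fun q _ =>
    Finset.sum_congr rfl fun r _ => by ring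

/-- Contracting the last two index pairs first. -/
theorem triplePairing_eq_sum_mul_sum (Z Y : Fin n → Fin n → Fin n → ℝ) :
    triplePairing H Z Y
      = ∑ a, ∑ p, H a p * ∑ b, ∑ r, (∑ c, H c r * Z a b c) * ∑ q, H b q * Y p q r := by
  simp only [Finset.sum_mul_sum]
  simp only [Finset.mul_sum]
  refine Finset.sum_congr rfl fun a _ => ?_
  conv_rhs => rw [Finset.sum_comm]
  refine Finset.sum_congr rfl fun b _ => ?_
  rw [sum_comm_pairs fun p r c q => H a p * (H c r * Z a b c * (H b q * Y p q r))]
  refine Finset.sum_congr rfl fun c _ => ?_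
  conv_rhs => rw [Finset.sum_comm]
  exact Finset.sum_congr rfl fun p _ => Finset.sum_congr rfl fun q _ =>
    Finset.sum_congr rfl fun r _ => by ring

end TriplePairing

namespace IsHessianPotential

variable {n : ℕ} {Ω : Set (Fin n → ℝ)} {Φ : (Fin n → ℝ) → ℝ} {x : Fin n → ℝ}

theorem pd3_rotate (h : IsHessianPotential Ω Φ) (hx : x ∈ Ω) (i j k : Fin n) :
    pd3 Φ i j k x = pd3 Φ j k i x := by
  rw [h.pd3_swap₁ hx, h.pd3_swap₂ hx]

theorem pairing_pd3 (h : IsHessianPotential Ω Φ) (hx : x ∈ Ω) (A : Fin n → Fin n → ℝ)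
    (j : Fin n) :
    pairing (ihess Φ x) A (fun a b => pd3 Φ j a b x)
      = ∑ a, ∑ b, A a b * ∑ d, ihess Φ x b d * raised3 Φ a j d x := by
  refine Finset.sum_congr rfl fun a _ => Finset.sum_congr rfl fun b _ => ?_
  simp only [raised3, Finset.mul_sum]
  rw [Finset.sum_comm]
  exact Finset.sum_congr rfl fun d _ => Finset.sum_congr rfl fun c _ => by
    rw [h.pd3_swap₁ hx j c d]; ring

theorem pairing_raised3_pd3 (B : Fin n → ℝ) (j : Fin n) :
    pairing (ihess Φ x) (fun a b => ∑ k, B k * raised3 Φ k a b x) (fun a b => pd3 Φ j a b x)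
      = ∑ s, ∑ m, B s * ihess Φ x s m * calabi Φ m j x := by
  simp only [pairing_sum_left, pairing_const_mul_left, raised3, Finset.mul_sum, mul_assoc]
  rfl

/-- The contraction `B_{am} Φ^{mk} Φ_{kib} Φ^{ac} Φ^{bd} Φ_{cdj}`. -/
def quadContraction (Φ : (Fin n → ℝ) → ℝ) (B : Fin n → Fin n → ℝ) (i j : Fin n)
    (x : Fin n → ℝ) : ℝ :=
  pairing (ihess Φ x) (fun a b => ∑ k, B a k * raised3 Φ k i b x) (fun a b => pd3 Φ j a b x)

theorem quadContraction_comm (h : IsHessianPotential Ω Φ) (hx : x ∈ Ω) {B : Fin n → Fin n → ℝ}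
    (hB : ∀ a b, B a b = B b a) (i j : Fin n) :
    quadContraction Φ B i j x = quadContraction Φ B j i x := by
  set H : Matrix (Fin n) (Fin n) ℝ := ihess Φ x
  set T : Fin n → Matrix (Fin n) (Fin n) ℝ := fun i => Matrix.of fun a b => pd3 Φ i a b x with hT
  set B₀ : Matrix (Fin n) (Fin n) ℝ := Matrix.of B
  have hH : Hᵀ = H := by ext a b; exact h.ihess_comm hx b a
  have hTt (i : Fin n) : (T i)ᵀ = T i := by ext a b; exact h.pd3_swap₂ hx i b a
  have hBt : B₀ᵀ = B₀ := by ext a b; exact hB b a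
  have key (i j : Fin n) : quadContraction Φ B i j x = (T i * H * B₀ * H * T j * H).trace := by
    have h1 : (fun a b => ∑ k, B a k * raised3 Φ k i b x) = B₀ * (H * T i) := by
      ext a b
      simp only [raised3, Matrix.mul_apply, B₀, H, hT, Matrix.of_apply, h.pd3_swap₁ hx _ i]
    rw [quadContraction, h1]
    refine (sum_contraction_eq_trace (B₀ * (H * T i)) (T j) H H).trans ?_
    simp only [Matrix.transpose_mul, hH, hTt, hBt, Matrix.mul_assoc]
  rw [key, key, ← Matrix.trace_transpose]
  simp only [Matrix.transpose_mul, hH, hTt, hBt]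
  rw [Matrix.trace_mul_comm]
  simp only [Matrix.mul_assoc]

theorem quadContraction_add_half (Φ : (Fin n → ℝ) → ℝ) (B C : Fin n → Fin n → ℝ) (i j : Fin n)
    (x : Fin n → ℝ) :
    quadContraction Φ (fun a b => B a b + 1 / 2 * C a b) i j x
      = quadContraction Φ B i j x + 1 / 2 * quadContraction Φ C i j x := by
  simp only [quadContraction, add_mul, Finset.sum_add_distrib, mul_assoc, ← Finset.mul_sum,
    pairing_add_left, pairing_const_mul_left]

theorem quadContraction_eq (h : IsHessianPotential Ω Φ) (hx : x ∈ Ω) (B : Fin n → Fin n → ℝ)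
    (i j : Fin n) :
    quadContraction Φ B i j x = ∑ a, ∑ m, ∑ k, ∑ b, ∑ c, ∑ d, B a m * ihess Φ x m k
      * pd3 Φ k i b x * ihess Φ x a c * ihess Φ x b d * pd3 Φ c d j x := by
  rw [quadContraction, pairing]
  refine Finset.sum_congr rfl fun a _ => ?_
  conv_rhs =>
    enter [2, m]
    rw [Finset.sum_comm]
  conv_rhs => rw [Finset.sum_comm]
  refine Finset.sum_congr rfl fun b _ => ?_
  rw [sum_comm_pairs fun m k c d => B a m * ihess Φ x m k * pd3 Φ k i b x * ihess Φ x a c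
    * ihess Φ x b d * pd3 Φ c d j x]
  refine Finset.sum_congr rfl fun c _ => Finset.sum_congr rfl fun d _ => ?_
  simp only [raised3, Finset.mul_sum, Finset.sum_mul]
  exact Finset.sum_congr rfl fun m _ => Finset.sum_congr rfl fun k _ => by
    rw [h.pd3_rotate hx j c d]; ring

/-! ### The curvature term -/

theorem Rcal_eq (h : IsHessianPotential Ω Φ) (hx : x ∈ Ω) (i a b c : Fin n) :
    Rcal Φ i a b c x = 1 / 4 * (thirdSq Φ i c a b x - thirdSq Φ i b a c x) := by
  rw [Rcal, h.thirdSq_eq hx, h.thirdSq_eq hx, ← Finset.sum_sub_distrib]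
  congr 1
  refine Finset.sum_congr rfl fun e _ => ?_
  simp only [raised3, Finset.mul_sum, ← Finset.sum_sub_distrib, h.pd3_rotate hx e]
  exact Finset.sum_congr rfl fun m _ => by ring

theorem triplePairing_thirdSq (h : IsHessianPotential Ω Φ) (hx : x ∈ Ω) (i j : Fin n) :
    triplePairing (ihess Φ x) (fun a b c => thirdSq Φ i c a b x) (fun a b c => thirdSq Φ j c a b x)
      = quadContraction Φ (fun a b => calabi Φ a b x) i j x := by
  have h1 (c r : Fin n) : pairing (ihess Φ x) (fun a b => thirdSq Φ i c a b x)
      (fun a b => thirdSq Φ j r a b x)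
      = ∑ l, ∑ m, raised3 Φ l j r x * (raised3 Φ m i c x * calabi Φ m l x) := by
    simp only [thirdSq, pairing_sum_left, pairing_sum_right (h.ihess_comm hx),
      pairing_const_mul_left, pairing_const_mul_right, Finset.mul_sum]
    rfl
  rw [triplePairing_eq_sum_pairing]
  simp only [h1]
  rw [quadContraction, h.pairing_pd3 hx]
  simp only [Finset.sum_mul_sum]
  simp only [Finset.mul_sum]
  rw [sum_comm_pairs]
  refine Finset.sum_congr rfl fun a _ => ?_
  conv_rhs => rw [Finset.sum_comm]
  exact Finset.sum_congr rfl fun k _ => Finset.sum_congr rfl fun b _ =>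
    Finset.sum_congr rfl fun d _ => by rw [h.calabi_comm hx]; ring

theorem sum_ihess_mul_raised3_swap (h : IsHessianPotential Ω Φ) (hx : x ∈ Ω) (a b c : Fin n) :
    ∑ k, ihess Φ x a k * raised3 Φ b c k x = ∑ k, ihess Φ x b k * raised3 Φ a c k x := by
  simp only [raised3, Finset.mul_sum]
  rw [Finset.sum_comm]
  exact Finset.sum_congr rfl fun k _ => Finset.sum_congr rfl fun m _ => by
    rw [h.pd3_swap₁ hx k c m, h.pd3_swap₂ hx c k m, h.pd3_swap₁ hx c m k]; ring

theorem triplePairing_thirdSq_cross (h : IsHessianPotential Ω Φ) (hx : x ∈ Ω) (i j : Fin n) :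
    triplePairing (ihess Φ x) (fun a b c => thirdSq Φ i c a b x) (fun a b c => thirdSq Φ j b a c x)
      = pairing (ihess Φ x) (fun a b => cubicTrace Φ i a b x) (fun a b => pd3 Φ j a b x) := by
  have h1 (a b r : Fin n) : ∑ c, ihess Φ x c r * thirdSq Φ i c a b x
      = ∑ m, raised3 Φ r m i x * raised3 Φ m a b x := by
    simp only [h.ihess_comm hx _ r, h.thirdSq_swap_left hx i, h.sum_ihess_mul_thirdSq hx]
  have h2 (b p r : Fin n) : ∑ q, ihess Φ x b q * thirdSq Φ j q p r x
      = ∑ s, raised3 Φ b s j x * raised3 Φ s p r x := by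
    simp only [h.thirdSq_swap_left hx j, h.sum_ihess_mul_thirdSq hx]
  rw [triplePairing_eq_sum_mul_sum, h.pairing_pd3 hx]
  simp only [h1, h2, Finset.sum_mul_sum, cubicTrace]
  simp only [Finset.mul_sum, Finset.sum_mul]
  conv_lhs =>
    enter [2, a]; rw [Finset.sum_comm]; enter [2, b]; rw [Finset.sum_comm]
    enter [2, r]; rw [Finset.sum_comm]; enter [2, m]; rw [Finset.sum_comm]
  conv_lhs =>
    rw [Finset.sum_comm]; enter [2, b]; rw [Finset.sum_comm]; enter [2, r]; rw [Finset.sum_comm]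
  conv_rhs =>
    enter [2, a]; rw [Finset.sum_comm]; enter [2, u]; rw [Finset.sum_comm]
    enter [2, v]; rw [Finset.sum_comm]; enter [2, w]; rw [Finset.sum_comm]
  conv_rhs =>
    enter [2, a, 2, u]; rw [Finset.sum_comm]; enter [2, v]; rw [Finset.sum_comm]
  refine Finset.sum_congr rfl fun b _ => Finset.sum_congr rfl fun r _ =>
    Finset.sum_congr rfl fun m _ => Finset.sum_congr rfl fun a _ =>
    Finset.sum_congr rfl fun s _ => ?_
  have h3 := congrArg (raised3 Φ r m i x * raised3 Φ m a b x * raised3 Φ b s j x * ·)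
    (h.sum_ihess_mul_raised3_swap hx a s r)
  simp only [Finset.mul_sum] at h3
  refine Eq.trans (Finset.sum_congr rfl fun p _ => ?_)
    (h3.trans (Finset.sum_congr rfl fun p _ => ?_))
  · rw [h.raised3_comm hx s p r]; ring
  · rw [h.ihess_comm hx s p, h.raised3_comm hx b s j]; ring

theorem triplePairing_Rcal (h : IsHessianPotential Ω Φ) (hx : x ∈ Ω) (i j : Fin n) :
    8 * triplePairing (ihess Φ x) (fun a b c => Rcal Φ i a b c x) (fun a b c => Rcal Φ j a b c x)
      = quadContraction Φ (fun a b => calabi Φ a b x) i j x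
        - 1 / 2 * (pairing (ihess Φ x) (fun a b => cubicTrace Φ i a b x) (fun a b => pd3 Φ j a b x)
          + pairing (ihess Φ x) (fun a b => cubicTrace Φ j a b x) (fun a b => pd3 Φ i a b x)) := by
  have h1 : triplePairing (ihess Φ x) (fun a b c => Rcal Φ i a b c x)
      (fun a b c => Rcal Φ j a b c x)
      = 1 / 16 * triplePairing (ihess Φ x)
        (fun a b c => thirdSq Φ i c a b x - thirdSq Φ i b a c x)
        (fun a b c => thirdSq Φ j c a b x - thirdSq Φ j b a c x) := by
    simp only [triplePairing, h.Rcal_eq hx, Finset.mul_sum]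
    refine Finset.sum_congr rfl fun a _ => Finset.sum_congr rfl fun b _ =>
      Finset.sum_congr rfl fun c _ => Finset.sum_congr rfl fun p _ =>
      Finset.sum_congr rfl fun q _ => Finset.sum_congr rfl fun r _ => ?_
    ring
  rw [h1, triplePairing_sub_sub, h.triplePairing_thirdSq hx, h.triplePairing_thirdSq_cross hx,
    triplePairing_comm (h.ihess_comm hx) (fun a b c => thirdSq Φ i b a c x),
    h.triplePairing_thirdSq_cross hx,
    triplePairing_swap (fun a b c => thirdSq Φ i c a b x) (fun a b c => thirdSq Φ j c a b x),
    h.triplePairing_thirdSq hx]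
  ring

end IsHessianPotential

namespace IsTransport

variable {n : ℕ} {Ω : Set (Fin n → ℝ)} {Φ V W : (Fin n → ℝ) → ℝ} {x : Fin n → ℝ}

theorem What2_comm (h : IsTransport Ω Φ V W) (i j : Fin n) :
    What2 Φ W i j x = What2 Φ W j i x := by
  rw [What2, Finset.sum_comm]
  exact Finset.sum_congr rfl fun a _ => Finset.sum_congr rfl fun b _ => by
    rw [h.pd2_target_comm]; ring

theorem pairing_LT3_pd3 (h : IsTransport Ω Φ V W) (hx : x ∈ Ω) (i j : Fin n) :
    pairing (ihess Φ x) (fun a b => LT3 Φ V W (pd3 Φ) i a b x) (fun a b => pd3 Φ j a b x)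
      = pairing (ihess Φ x) (fun a b => What3 Φ W i a b x - pd3 V i a b x)
          (fun a b => pd3 Φ j a b x)
        + 1 / 2 * ∑ s, ∑ m, (pd2 V i s x + What2 Φ W i s x) * ihess Φ x s m * calabi Φ m j x
        + 1 / 4 * ∑ s, ∑ m, calabi Φ i s x * ihess Φ x s m * calabi Φ m j x
        + IsHessianPotential.quadContraction Φ (fun a b => pd2 V a b x + What2 Φ W a b x) i j x
        + 1 / 2 * IsHessianPotential.quadContraction Φ (fun a b => calabi Φ a b x) i j x
        - 1 / 2 * pairing (ihess Φ x) (fun a b => cubicTrace Φ i a b x)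
          (fun a b => pd3 Φ j a b x) := by
  set A : Fin n → Fin n → ℝ := fun a b => pd2 V a b x + What2 Φ W a b x with hA
  have h1 := IsHessianPotential.quadContraction_add_half Φ A (fun a b => calabi Φ a b x) i j x
  have h2 := pairing_transpose_left (ihess Φ x)
    (fun a b => ∑ k, (A a k + 1 / 2 * calabi Φ a k x) * raised3 Φ k i b x)
    (h.pd3_swap₂ hx j)
  have h3 := IsHessianPotential.pairing_raised3_pd3 (Φ := Φ) (x := x)
    (fun k => A i k + 1 / 2 * calabi Φ i k x) j
  rw [IsHessianPotential.quadContraction] at h1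
  simp only [h.LT3_pd3 hx, pairing_sub_left, pairing_add_left, pairing_const_mul_left]
  simp only [hA] at h1 h2 h3
  rw [h1] at h2
  rw [h1, h2, h3]
  simp only [add_mul, mul_assoc, Finset.sum_add_distrib, ← Finset.mul_sum]
  ring

end IsTransport

/-- the weighted tensor Laplacian of the Calabi tensor `g`. -/
theorem stmt_8 {n : ℕ} (Ω : Set (Fin n → ℝ)) (hΩ : IsOpen Ω)
    (Φ V W : (Fin n → ℝ) → ℝ)
    (hΦ : ContDiffOn ℝ 5 Φ Ω) (hΦconv : ConvexOn ℝ Ω Φ)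
    (hpos : ∀ x ∈ Ω, (hess Φ x).PosDef)
    (hV : ContDiffOn ℝ 3 V Ω) (hW : ContDiff ℝ 3 W)
    (hMA : ∀ x ∈ Ω, Real.exp (-V x) = Real.exp (-W (grad Φ x)) * (hess Φ x).det) :
    ∀ x ∈ Ω, ∀ i j : Fin n,
      LT2 Φ V W (calabi Φ) i j x
      = (∑ a, ∑ b, ∑ c, ∑ d, (What3 Φ W i a b x - pd3 V i a b x)
          * ihess Φ x a c * ihess Φ x b d * pd3 Φ j c d x)
        + (∑ a, ∑ b, ∑ c, ∑ d, (What3 Φ W j a b x - pd3 V j a b x)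
          * ihess Φ x a c * ihess Φ x b d * pd3 Φ i c d x)
        + (1/2) * (∑ s, ∑ m,
            ((pd2 V i s x + What2 Φ W i s x) * ihess Φ x s m * calabi Φ m j x
              + (pd2 V j s x + What2 Φ W j s x) * ihess Φ x s m * calabi Φ m i x))
        + 2 * (∑ a, ∑ m, ∑ k, ∑ b, ∑ c, ∑ d,
            (pd2 V a m x + What2 Φ W a m x) * ihess Φ x m k * pd3 Φ k i b x
              * ihess Φ x a c * ihess Φ x b d * pd3 Φ c d j x)
        + (1/2) * (∑ k, ∑ m, calabi Φ k i x * ihess Φ x k m * calabi Φ m j x)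
        + 2 * (∑ p, ∑ q, ∑ a, ∑ b, ∑ c, ∑ d,
            Ncal Φ p i a b x * Ncal Φ q j c d x
              * ihess Φ x p q * ihess Φ x a c * ihess Φ x b d)
        + 8 * (∑ a, ∑ b, ∑ c, ∑ p, ∑ q, ∑ r,
            Rcal Φ i a b c x * Rcal Φ j p q r x
              * ihess Φ x a p * ihess Φ x b q * ihess Φ x c r) := by

  intro x hx i j
  have h : IsTransport Ω Φ V W := ⟨⟨hΩ, hΦ, hpos⟩, hV, hW, hMA⟩
  have hA (a b : Fin n) : pd2 V a b x + What2 Φ W a b x = pd2 V b a x + What2 Φ W b a x := by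
    rw [h.What2_comm, pd2_comm hΩ hV (by norm_num) hx]
  have hS (i j : Fin n) : ∑ a, ∑ b, ∑ c, ∑ d, (What3 Φ W i a b x - pd3 V i a b x)
        * ihess Φ x a c * ihess Φ x b d * pd3 Φ j c d x
      = pairing (ihess Φ x) (fun a b => What3 Φ W i a b x - pd3 V i a b x)
        (fun a b => pd3 Φ j a b x) :=
    Finset.sum_congr rfl fun a _ => Finset.sum_congr rfl fun b _ =>
      Finset.sum_congr rfl fun c _ => Finset.sum_congr rfl fun d _ => by ring
  have hN : ∑ p, ∑ q, ∑ a, ∑ b, ∑ c, ∑ d, Ncal Φ p i a b x * Ncal Φ q j c d x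
        * ihess Φ x p q * ihess Φ x a c * ihess Φ x b d
      = ∑ p, ∑ q, ihess Φ x p q * pairing (ihess Φ x)
        (fun a b => Ncal Φ p i a b x) (fun a b => Ncal Φ q j a b x) := by
    simp only [pairing, Finset.mul_sum]
    exact Finset.sum_congr rfl fun p _ => Finset.sum_congr rfl fun q _ =>
      Finset.sum_congr rfl fun a _ => Finset.sum_congr rfl fun b _ =>
      Finset.sum_congr rfl fun c _ => Finset.sum_congr rfl fun d _ => by ring
  have hg : ∑ s, ∑ m, calabi Φ i s x * ihess Φ x s m * calabi Φ m j x
      = ∑ k, ∑ m, calabi Φ k i x * ihess Φ x k m * calabi Φ m j x :=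
    Finset.sum_congr rfl fun s _ => by simp only [h.calabi_comm hx i s]
  have hg' : ∑ s, ∑ m, calabi Φ j s x * ihess Φ x s m * calabi Φ m i x
      = ∑ k, ∑ m, calabi Φ k i x * ihess Φ x k m * calabi Φ m j x := by
    rw [Finset.sum_comm]
    exact Finset.sum_congr rfl fun s _ => Finset.sum_congr rfl fun m _ => by
      rw [h.calabi_comm hx j, h.ihess_comm hx m]; ring
  have hR := h.triplePairing_Rcal hx i j
  rw [triplePairing] at hR
  rw [hS, hS, hN, hR, ← h.quadContraction_eq hx fun a b => pd2 V a b x + What2 Φ W a b x,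
    h.LT2_calabi hx, h.pairing_LT3_pd3 hx, h.pairing_LT3_pd3 hx, hg, hg',
    h.quadContraction_comm hx hA j i,
    h.quadContraction_comm hx (h.calabi_comm hx) j i]
  simp only [Finset.sum_add_distrib]
  ring
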